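/- arXiv:1706.04101 — 3 statements merged into one kernel-verified Lean document; each statement's English description precedes it below -/
import Mathlib

section
/- For every ε > 0 there exist δ > 0 and Q₀ such that for all real Q ≥ Q₀ and all nonempty finite sets A, B of positive integers contained in [1, Q]: if E(A,B) ≥ |A|·|B|·exp((2·log 2 − δ)·(log Q)/(log log Q)), then the quotient set satisfies |A/B| ≥ |A|·|B|·exp(−ε·(log Q)/(log log Q)). -/
open Finset

/-- number of prime factors exceeding `y`, with multiplicity -/
noncomputable def rOm (y : ℝ) (n : ℕ) : ℕ :=
  ∑ p ∈ n.primeFactors, if (p : ℝ) ≤ y then 0 else n.factorization p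

lemma rOm_eq (y : ℝ) (n : ℕ) (S : Finset ℕ) (h : n.primeFactors ⊆ S) :
    rOm y n = ∑ p ∈ S, if (p : ℝ) ≤ y then 0 else n.factorization p := by
  unfold rOm
  apply Finset.sum_subset h
  intro p _ hp
  have : n.factorization p = 0 := by
    rw [← Nat.support_factorization] at hp
    exact Finsupp.notMem_support_iff.1 hp
  simp [this]

lemma rOm_mul (y : ℝ) {a b : ℕ} (ha : a ≠ 0) (hb : b ≠ 0) :
    rOm y (a * b) = rOm y a + rOm y b := by
  have h := Nat.primeFactors_mul ha hb
  rw [rOm_eq y a _ (h ▸ Finset.subset_union_left), rOm_eq y b _ (h ▸ Finset.subset_union_right),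
    rOm, ← Finset.sum_add_distrib]
  apply Finset.sum_congr rfl
  intro p _
  rw [Nat.factorization_mul ha hb]
  split_ifs <;> simp

lemma rOm_pow_le (y : ℝ) (hy : 0 ≤ y) {n : ℕ} (hn : n ≠ 0) : y ^ rOm y n ≤ n := by
  have h : (n : ℝ) = ∏ p ∈ n.primeFactors, (p : ℝ) ^ n.factorization p := by
    conv_lhs => rw [← Nat.prod_factorization_pow_eq_self hn]
    rw [Finsupp.prod, Nat.support_factorization]
    push_cast
    rfl
  rw [h, rOm, ← Finset.prod_pow_eq_pow_sum]
  apply Finset.prod_le_prod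
  · intros; positivity
  · intro p hp
    have h1 : (1 : ℝ) ≤ p := by exact_mod_cast (Nat.prime_of_mem_primeFactors hp).one_le
    split_ifs with h2
    · simpa using one_le_pow₀ h1
    · exact pow_le_pow_left₀ hy (by linarith) _

lemma small_primes_prod (y c : ℝ) (hc : 1 ≤ c) (n : ℕ) :
    ∏ p ∈ n.primeFactors, (if (p : ℝ) ≤ y then c else 1) ≤ c ^ ⌊y⌋₊ := by
  rw [Finset.prod_ite]
  simp only [prod_const, one_pow, mul_one]
  apply pow_le_pow_right₀ hc
  calc _ ≤ (Finset.Icc 1 ⌊y⌋₊).card := by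
        apply Finset.card_le_card
        intro p hp
        rw [Finset.mem_filter] at hp
        rw [Finset.mem_Icc]
        exact ⟨(Nat.prime_of_mem_primeFactors hp.1).one_le, Nat.le_floor hp.2⟩
    _ = _ := by simp

lemma kpow (i j : ℕ) : ((i + j + 1 : ℕ) : ℝ) ≤ 2 ^ i * 2 ^ j * (3 / 4 : ℝ) ^ (min i j) := by
  wlog h : i ≤ j generalizing i j
  · have := this j i (by omega)
    rw [min_comm, add_comm i j, mul_comm (2 ^ i : ℝ)]
    exact this
  rw [min_eq_left h]
  have e : (2 : ℝ) ^ i * 2 ^ j * (3 / 4 : ℝ) ^ i = 3 ^ i * 2 ^ (j - i) := by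
    obtain ⟨k, rfl⟩ := Nat.exists_eq_add_of_le h
    simp only [Nat.add_sub_cancel_left]
    rw [div_pow, pow_add, show (4 : ℝ) = 2 * 2 by norm_num, mul_pow]
    field_simp
  rw [e]
  obtain ⟨k, rfl⟩ := Nat.exists_eq_add_of_le h
  simp only [Nat.add_sub_cancel_left]
  have h1 : 2 * i + 1 ≤ 3 ^ i := by
    clear h e
    induction i with
    | zero => simp
    | succ n ih => rw [pow_succ]; omega
  have h2 : k + 1 ≤ 2 ^ k := Nat.lt_two_pow_self
  have : i + (i + k) + 1 ≤ 3 ^ i * 2 ^ k := by nlinarith [Nat.mul_le_mul h1 h2]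
  exact_mod_cast this

lemma tau_le (y : ℝ) {a b : ℕ} (ha : a ≠ 0) (hb : b ≠ 0) (D : ℕ)
    (hDa : ∀ p, a.factorization p ≤ D) (hDb : ∀ p, b.factorization p ≤ D) :
    ((a * b).divisors.card : ℝ) ≤ (2 * D + 1 : ℝ) ^ ⌊y⌋₊ *
      (2 ^ rOm y a * 2 ^ rOm y b * (3 / 4 : ℝ) ^ rOm y (Nat.gcd a b)) := by
  have h := Nat.primeFactors_mul ha hb
  have hab : a * b ≠ 0 := mul_ne_zero ha hb
  rw [rOm_eq y a (a * b).primeFactors (h ▸ Finset.subset_union_left),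
    rOm_eq y b (a * b).primeFactors (h ▸ Finset.subset_union_right),
    rOm_eq y (Nat.gcd a b) (a * b).primeFactors
      (Nat.primeFactors_mono ((Nat.gcd_dvd_left a b).trans (dvd_mul_right a b)) hab)]
  rw [Nat.card_divisors hab]
  push_cast
  refine le_trans ?_ (mul_le_mul_of_nonneg_right
    (small_primes_prod y (2 * D + 1 : ℝ) (by linarith [(Nat.cast_nonneg D : (0 : ℝ) ≤ D)]) (a * b))
    (by positivity))
  simp only [← Finset.prod_pow_eq_pow_sum]
  simp only [← Finset.prod_mul_distrib]
  apply Finset.prod_le_prod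
  · intros; positivity
  · intro p _
    rw [Nat.factorization_mul ha hb, Nat.factorization_gcd ha hb]
    have h1 : (a.factorization p : ℝ) ≤ D := by exact_mod_cast hDa p
    have h2 : (b.factorization p : ℝ) ≤ D := by exact_mod_cast hDb p
    split_ifs
    · simp; linarith
    · have := kpow (a.factorization p) (b.factorization p)
      simpa using this

lemma sum_divisors_le (y x : ℝ) (hx : 0 < x) (hx1 : x ≤ 1) {a : ℕ} (ha : a ≠ 0) (D : ℕ)
    (hDa : ∀ p, a.factorization p ≤ D) :
    ∑ g ∈ a.divisors, x ^ rOm y g ≤ (2 * D + 1 : ℝ) ^ ⌊y⌋₊ * (1 + x) ^ rOm y a := by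
  let f : ArithmeticFunction ℝ := ⟨fun n => if n = 0 then 0 else x ^ rOm y n, by simp⟩
  have hf : f.IsMultiplicative := by
    rw [ArithmeticFunction.IsMultiplicative.iff_ne_zero]
    constructor
    · simp [f, rOm]
    · intro m n hm hn _
      simp [f, hm, hn, rOm_mul y hm hn, pow_add]
  have hg := hf.mul (ArithmeticFunction.isMultiplicative_zeta.natCast (R := ℝ))
  have hgv : ∀ n, (f * ((ArithmeticFunction.zeta : ArithmeticFunction ℕ) : ArithmeticFunction ℝ)) n
      = ∑ g ∈ n.divisors, x ^ rOm y g := by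
    intro n
    rw [ArithmeticFunction.coe_mul_zeta_apply]
    apply Finset.sum_congr rfl
    intro g hg
    have : g ≠ 0 := (Nat.pos_of_mem_divisors hg).ne'
    simp [f, this]
  rw [← hgv, hg.multiplicative_factorization _ ha, Finsupp.prod, Nat.support_factorization]
  refine le_trans ?_ (mul_le_mul_of_nonneg_right
    (small_primes_prod y (2 * D + 1 : ℝ) (by linarith [(Nat.cast_nonneg D : (0 : ℝ) ≤ D)]) a)
    (by positivity))
  rw [rOm]
  simp only [← Finset.prod_pow_eq_pow_sum]
  simp only [← Finset.prod_mul_distrib]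
  apply Finset.prod_le_prod
  · intro p _
    rw [hgv]; positivity
  · intro p hp
    have hpp := Nat.prime_of_mem_primeFactors hp
    rw [hgv, Nat.sum_divisors_prime_pow hpp]
    have hr : ∀ i, rOm y (p ^ i) = if (p : ℝ) ≤ y then 0 else i := by
      intro i
      rw [rOm_eq y (p ^ i) {p} (fun q hq => by
        rw [Finset.mem_singleton]
        exact (Nat.prime_dvd_prime_iff_eq (Nat.prime_of_mem_primeFactors hq) hpp).1
          ((Nat.prime_of_mem_primeFactors hq).dvd_of_dvd_pow (Nat.dvd_of_mem_primeFactors hq)))]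
      simp [hpp.factorization]
    simp only [hr]
    have h1 : (a.factorization p : ℝ) ≤ D := by exact_mod_cast hDa p
    split_ifs
    · simp; linarith
    · rw [one_mul]
      generalize a.factorization p = k
      induction k with
      | zero => simp
      | succ k ih =>
        rw [Finset.sum_range_succ, pow_succ (1 + x)]
        have : x ^ (k + 1) ≤ x * (1 + x) ^ k := by
          rw [pow_succ, mul_comm]
          gcongr
          linarith
        nlinarith

lemma core (A B : Finset ℕ) (hA : ∀ a ∈ A, 0 < a) (hB : ∀ b ∈ B, 0 < b) (G : ℕ → Prop)
    [DecidablePred G] (T : ℝ)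
    (hTA : ∀ a ∈ A, ((a.divisors.filter G).card : ℝ) ≤ T)
    (hTB : ∀ b ∈ B, ((b.divisors.filter G).card : ℝ) ≤ T) :
    (((A ×ˢ B).filter (fun q => G (Nat.gcd q.1 q.2))).card : ℝ) ^ 2 ≤
      (((A ×ˢ B).image (fun p => (p.1 : ℚ) / (p.2 : ℚ))).card : ℝ) * (A.card * T) *
        (B.card * T) := by
  set P := (A ×ˢ B).filter (fun q => G (Nat.gcd q.1 q.2)) with hP
  set M := ((A ×ˢ B).image (fun p => (p.1 : ℚ) / (p.2 : ℚ))).card with hM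
  set I := P.image (fun q => Nat.gcd q.1 q.2) with hI
  have hIG : ∀ g ∈ I, G g := by
    intro g hg
    simp only [hI, hP, mem_image, mem_filter] at hg
    obtain ⟨q, hq, rfl⟩ := hg
    exact hq.2
  have hPc : (P.card : ℝ) = ∑ g ∈ I, ((P.filter (fun q => Nat.gcd q.1 q.2 = g)).card : ℝ) := by
    rw [Finset.card_eq_sum_card_image (fun q : ℕ × ℕ => Nat.gcd q.1 q.2) P]
    push_cast
    rfl
  have key : ∀ (C : Finset ℕ), (∀ c ∈ C, 0 < c) →
      (∀ c ∈ C, ((c.divisors.filter G).card : ℝ) ≤ T) →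
      ∑ g ∈ I, ((C.filter (fun c => g ∣ c)).card : ℝ) ≤ C.card * T := by
    intro C hC hT
    have : ∑ g ∈ I, ((C.filter (fun c => g ∣ c)).card : ℝ)
        = ∑ c ∈ C, ((I.filter (fun g => g ∣ c)).card : ℝ) := by
      simp only [Finset.card_filter]
      push_cast
      rw [Finset.sum_comm]
    rw [this, ← nsmul_eq_mul]
    apply Finset.sum_le_card_nsmul
    intro c hc
    refine le_trans ?_ (hT c hc)
    norm_cast
    apply Finset.card_le_card
    intro g hg
    rw [mem_filter] at hg ⊢
    exact ⟨Nat.mem_divisors.2 ⟨hg.2, (hC c hc).ne'⟩, hIG g hg.1⟩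
  have hT0 : (0 : ℝ) ≤ A.card * T :=
    le_trans (Finset.sum_nonneg (fun _ _ => by positivity)) (key A hA hTA)
  rw [hPc]
  refine le_trans (Finset.sum_sq_le_sum_mul_sum_of_sq_le_mul I
    (f := fun g => (M : ℝ) * ((A.filter (fun c => g ∣ c)).card : ℝ))
    (g := fun g => ((B.filter (fun c => g ∣ c)).card : ℝ)) (fun _ _ => by positivity)
    (fun _ _ => by positivity) ?_) ?_
  · intro g hg
    have h1 : (P.filter (fun q => Nat.gcd q.1 q.2 = g)).card ≤ M := by
      rw [hM]
      apply Finset.card_le_card_of_injOn (fun p => (p.1 : ℚ) / (p.2 : ℚ))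
      · intro q hq
        simp only [hP, coe_filter, mem_filter, Set.mem_ofPred_eq] at hq
        exact Finset.mem_coe.2 (Finset.mem_image_of_mem _ hq.1.1)
      · rintro ⟨a, b⟩ hq ⟨c, d⟩ hq' h
        simp only [hP, coe_filter, mem_filter, Set.mem_ofPred_eq, mem_product] at hq hq' h
        have ha := hA a hq.1.1.1
        have hb := hB b hq.1.1.2
        have hc := hA c hq'.1.1.1
        have hd := hB d hq'.1.1.2
        rw [div_eq_div_iff (by positivity) (by positivity)] at h
        have h' : a * d = c * b := by exact_mod_cast h
        have e1 : Nat.gcd (a * c) (a * d) = a * g := by rw [Nat.gcd_mul_left, hq'.2]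
        have e2 : Nat.gcd (a * c) (c * b) = c * g := by
          rw [mul_comm a c, Nat.gcd_mul_left, hq.2]
        have hgp : 0 < g := hq.2 ▸ Nat.gcd_pos_of_pos_left _ ha
        have hac : a = c := by
          rw [h', e2] at e1
          exact (Nat.eq_of_mul_eq_mul_right hgp e1).symm
        subst hac
        have := Nat.eq_of_mul_eq_mul_left ha (h'.trans rfl)
        rw [this]
    have h2 : (P.filter (fun q => Nat.gcd q.1 q.2 = g)).card ≤
        (A.filter (fun c => g ∣ c)).card * (B.filter (fun c => g ∣ c)).card := by
      rw [← Finset.card_product]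
      apply Finset.card_le_card
      rintro ⟨a, b⟩ hq
      simp only [hP, mem_filter, mem_product] at hq ⊢
      obtain ⟨⟨⟨u1, u2⟩, _⟩, rfl⟩ := hq
      exact ⟨⟨u1, Nat.gcd_dvd_left _ _⟩, u2, Nat.gcd_dvd_right _ _⟩
    have := Nat.mul_le_mul h1 h2
    rw [sq, mul_assoc]
    exact_mod_cast this
  · rw [← Finset.mul_sum]
    have k1 := key A hA hTA
    have k2 := key B hB hTB
    exact mul_le_mul (mul_le_mul_of_nonneg_left k1 (Nat.cast_nonneg _)) k2
      (Finset.sum_nonneg (fun _ _ => Nat.cast_nonneg _)) (mul_nonneg (Nat.cast_nonneg _) hT0)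

lemma energy_le (A B : Finset ℕ) (hA : ∀ a ∈ A, 0 < a) (hB : ∀ b ∈ B, 0 < b) :
    ((A ×ˢ A ×ˢ B ×ˢ B).filter (fun q => q.1 * q.2.2.1 = q.2.1 * q.2.2.2)).card ≤
      ∑ q ∈ A ×ˢ B, (q.1 * q.2).divisors.card := by
  rw [← Finset.card_sigma]
  apply Finset.card_le_card_of_injOn
    (fun q => (⟨(q.1, q.2.2.1), q.2.1⟩ : Sigma (fun _ : ℕ × ℕ => ℕ)))
  · rintro ⟨a, c, b, d⟩ hq
    simp only [coe_filter, Set.mem_ofPred_eq, mem_product] at hq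
    simp only [coe_sigma, Set.mem_sigma_iff, mem_coe, mem_product, Nat.mem_divisors]
    obtain ⟨⟨h1, h2, h3, h4⟩, h5⟩ := hq
    exact ⟨⟨h1, h3⟩, h5 ▸ dvd_mul_right _ _, (Nat.mul_pos (hA _ h1) (hB _ h3)).ne'⟩
  · rintro ⟨a, c, b, d⟩ hq ⟨a', c', b', d'⟩ hq' h
    simp only [coe_filter, Set.mem_ofPred_eq, mem_product] at hq hq'
    simp only [Sigma.mk.injEq, Prod.mk.injEq, heq_eq_eq] at h
    obtain ⟨⟨rfl, rfl⟩, rfl⟩ := h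
    have := Nat.eq_of_mul_eq_mul_left (hA _ hq.1.2.1) (hq.2.symm.trans hq'.2)
    rw [this]

lemma middle (A B : Finset ℕ) (hA : ∀ a ∈ A, 0 < a) (hB : ∀ b ∈ B, 0 < b)
    (hAn : A.Nonempty) (hBn : B.Nonempty)
    (y L δ x : ℝ) (D : ℕ) (hx : 0 < x) (hx1 : x ≤ 1)
    (hδL : 1 ≤ δ * L)
    (hS : (2 * D + 1 : ℝ) ^ ⌊y⌋₊ ≤ Real.exp (δ * L))
    (hD : ∀ n ∈ A ∪ B, ∀ p, n.factorization p ≤ D)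
    (h2 : ∀ n ∈ A ∪ B, (2 : ℝ) ^ rOm y n ≤ Real.exp ((Real.log 2 + 2 * δ) * L))
    (hr : ∀ n ∈ A ∪ B, (rOm y n : ℝ) ≤ 2 * L)
    (hE : (((A ×ˢ A ×ˢ B ×ˢ B).filter
            (fun q => q.1 * q.2.2.1 = q.2.1 * q.2.2.2)).card : ℝ) ≥
          (A.card : ℝ) * (B.card : ℝ) * Real.exp ((2 * Real.log 2 - δ) * L)) :
    (((A ×ˢ B).image (fun p => (p.1 : ℚ) / (p.2 : ℚ))).card : ℝ) ≥
          (A.card : ℝ) * (B.card : ℝ) *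
            Real.exp (-(δ * (16 - 56 * Real.log x) + 4 * x) * L) := by
  classical
  have hAc : (0 : ℝ) < A.card := by exact_mod_cast hAn.card_pos
  have hBc : (0 : ℝ) < B.card := by exact_mod_cast hBn.card_pos
  set G : ℕ → Prop := fun g => (rOm y g : ℝ) ≤ 28 * δ * L with hG
  set P := (A ×ˢ B).filter (fun q => G (Nat.gcd q.1 q.2)) with hP
  have hlx : Real.log x ≤ 0 := Real.log_nonpos hx.le hx1
  set T := Real.exp ((28 * δ * (-Real.log x) + δ + 2 * x) * L) with hT
  -- counting admissible divisors
  have hcount : ∀ n ∈ A ∪ B, ((n.divisors.filter G).card : ℝ) ≤ T := by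
    intro n hn
    have hn0 : n ≠ 0 := by
      rcases Finset.mem_union.1 hn with h | h
      · exact (hA n h).ne'
      · exact (hB n h).ne'
    have h1 := sum_divisors_le y x hx hx1 hn0 D (hD n hn)
    have h3 : ((n.divisors.filter G).card : ℝ) * Real.exp (28 * δ * L * Real.log x) ≤
        ∑ g ∈ n.divisors, x ^ rOm y g := by
      refine le_trans ?_ (Finset.sum_le_sum_of_subset_of_nonneg
        (Finset.filter_subset G n.divisors) (fun _ _ _ => by positivity))
      rw [← nsmul_eq_mul]
      apply Finset.card_nsmul_le_sum
      intro g hg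
      have hg2 : (rOm y g : ℝ) ≤ 28 * δ * L := (Finset.mem_filter.1 hg).2
      rw [← Real.rpow_natCast, Real.rpow_def_of_pos hx]
      apply Real.exp_le_exp.2
      nlinarith
    have h4 : (1 + x) ^ rOm y n ≤ Real.exp (2 * x * L) := by
      calc (1 + x) ^ rOm y n ≤ (Real.exp x) ^ rOm y n := by
            gcongr
            linarith [Real.add_one_le_exp x]
        _ = Real.exp (rOm y n * x) := by rw [← Real.exp_nat_mul]
        _ ≤ _ := by
            apply Real.exp_le_exp.2
            nlinarith [hr n hn]
    have h5 : ((n.divisors.filter G).card : ℝ) * Real.exp (28 * δ * L * Real.log x) ≤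
        Real.exp (δ * L) * Real.exp (2 * x * L) :=
      h3.trans (h1.trans (mul_le_mul hS h4 (by positivity) (by positivity)))
    have h6 : T * Real.exp (28 * δ * L * Real.log x) = Real.exp (δ * L) * Real.exp (2 * x * L) := by
      rw [hT, ← Real.exp_add, ← Real.exp_add]
      congr 1
      ring
    rw [← h6] at h5
    exact le_of_mul_le_mul_right h5 (Real.exp_pos _)
  have hcore := core A B hA hB G T (fun a ha => hcount a (Finset.mem_union_left _ ha))
    (fun b hb => hcount b (Finset.mem_union_right _ hb))
  rw [← hP] at hcore
  -- energy upper bound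
  set K := Real.exp (δ * L) * (Real.exp ((Real.log 2 + 2 * δ) * L) *
    Real.exp ((Real.log 2 + 2 * δ) * L)) with hK
  have hKp : 0 < K := by positivity
  have hE1 : (((A ×ˢ A ×ˢ B ×ˢ B).filter
            (fun q => q.1 * q.2.2.1 = q.2.1 * q.2.2.2)).card : ℝ) ≤
      K * ∑ q ∈ A ×ˢ B, (3 / 4 : ℝ) ^ rOm y (Nat.gcd q.1 q.2) := by
    refine le_trans (Nat.cast_le.2 (energy_le A B hA hB)) ?_
    rw [Nat.cast_sum]
    rw [Finset.mul_sum]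
    apply Finset.sum_le_sum
    rintro ⟨a, b⟩ hq
    obtain ⟨ha, hb⟩ := Finset.mem_product.1 hq
    have ha' := Finset.mem_union_left B ha
    have hb' := Finset.mem_union_right A hb
    refine (tau_le y (hA a ha).ne' (hB b hb).ne' D (hD a ha') (hD b hb')).trans ?_
    rw [hK, mul_assoc (Real.exp (δ * L))]
    have u1 := h2 a ha'
    have u2 := h2 b hb'
    gcongr
  have hE2 : ∑ q ∈ A ×ˢ B, (3 / 4 : ℝ) ^ rOm y (Nat.gcd q.1 q.2) ≤
      P.card + A.card * B.card * Real.exp (-(7 * δ * L)) := by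
    have : ∀ q ∈ A ×ˢ B, (3 / 4 : ℝ) ^ rOm y (Nat.gcd q.1 q.2) ≤
        (if G (Nat.gcd q.1 q.2) then 1 else 0) + Real.exp (-(7 * δ * L)) := by
      intro q _
      split_ifs with h
      · have : (3 / 4 : ℝ) ^ rOm y (Nat.gcd q.1 q.2) ≤ 1 :=
          pow_le_one₀ (by norm_num) (by norm_num)
        linarith [Real.exp_pos (-(7 * δ * L))]
      · rw [zero_add]
        have h' : 28 * δ * L < rOm y (Nat.gcd q.1 q.2) := not_le.1 h
        rw [← Real.rpow_natCast, Real.rpow_def_of_pos (by norm_num)]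
        apply Real.exp_le_exp.2
        have : Real.log (3 / 4) ≤ -(1 / 4) := by
          have := Real.log_le_sub_one_of_pos (show (0 : ℝ) < 3 / 4 by norm_num)
          linarith
        nlinarith
    refine (Finset.sum_le_sum this).trans ?_
    rw [Finset.sum_add_distrib, Finset.sum_const, Finset.card_product, hP, Finset.card_filter]
    push_cast
    simp
  have hPl : (A.card : ℝ) * B.card * Real.exp (-(7 * δ * L)) ≤ P.card := by
    have h1 := hE.le.trans (hE1.trans (mul_le_mul_of_nonneg_left hE2 hKp.le))
    have h3 : Real.exp ((2 * Real.log 2 - δ) * L) = K * Real.exp (-(6 * δ * L)) := by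
      rw [hK, ← Real.exp_add, ← Real.exp_add, ← Real.exp_add]
      congr 1
      ring
    rw [h3] at h1
    have h4 : (A.card : ℝ) * B.card * Real.exp (-(6 * δ * L)) ≤
        P.card + A.card * B.card * Real.exp (-(7 * δ * L)) := by
      apply le_of_mul_le_mul_left _ hKp
      linarith
    have h5 : 2 * Real.exp (-(7 * δ * L)) ≤ Real.exp (-(6 * δ * L)) := by
      have e : Real.exp (-(6 * δ * L)) = Real.exp (δ * L) * Real.exp (-(7 * δ * L)) := by
        rw [← Real.exp_add]
        congr 1
        ring
      rw [e]
      have : 2 ≤ Real.exp (δ * L) := by linarith [Real.add_one_le_exp (δ * L)]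
      gcongr
    have h6 := mul_le_mul_of_nonneg_left h5 (mul_pos hAc hBc).le
    linarith
  set M := (((A ×ˢ B).image (fun p => (p.1 : ℚ) / (p.2 : ℚ))).card : ℝ) with hM
  have hsq : ((A.card : ℝ) * B.card * Real.exp (-(7 * δ * L))) ^ 2 ≤ M * (A.card * T) *
      (B.card * T) := le_trans (by gcongr) hcore
  have hfin : (A.card : ℝ) * B.card * Real.exp (-(δ * (16 - 56 * Real.log x) + 4 * x) * L) * T ^ 2
      = A.card * B.card * Real.exp (-(7 * δ * L)) ^ 2 := by
    rw [mul_assoc, hT, ← Real.exp_nat_mul, ← Real.exp_nat_mul, ← Real.exp_add]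
    congr 2
    push_cast
    ring
  have hTp : 0 < T := Real.exp_pos _
  have hpos : 0 < (A.card : ℝ) * B.card * T ^ 2 := by positivity
  refine le_of_mul_le_mul_right (a := (A.card : ℝ) * B.card * T ^ 2) ?_ hpos
  calc _ = (A.card : ℝ) * B.card * ((A.card : ℝ) * B.card *
        Real.exp (-(δ * (16 - 56 * Real.log x) + 4 * x) * L) * T ^ 2) := by ring
    _ = ((A.card : ℝ) * B.card * Real.exp (-(7 * δ * L))) ^ 2 := by rw [hfin]; ring
    _ ≤ _ := hsq
    _ = _ := by ring

set_option maxHeartbeats 1600000 in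
/-- For every ε > 0 there exist δ > 0 and Q₀ such that for all real Q ≥ Q₀ and all
nonempty finite sets A, B of positive integers contained in [1, Q]: if the
multiplicative energy satisfies E(A,B) ≥ |A|·|B|·exp((2·log 2 − δ)·(log Q)/(log log Q)),
then the quotient set satisfies |A/B| ≥ |A|·|B|·exp(−ε·(log Q)/(log log Q)). -/
theorem stmt_13 :
    ∀ ε : ℝ, 0 < ε → ∃ δ : ℝ, 0 < δ ∧ ∃ Q₀ : ℝ, ∀ Q : ℝ, Q₀ ≤ Q →
      ∀ A B : Finset ℕ, A.Nonempty → B.Nonempty →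
        (∀ a ∈ A, 0 < a ∧ (a : ℝ) ≤ Q) →
        (∀ b ∈ B, 0 < b ∧ (b : ℝ) ≤ Q) →
        (((A ×ˢ A ×ˢ B ×ˢ B).filter
            (fun q => q.1 * q.2.2.1 = q.2.1 * q.2.2.2)).card : ℝ) ≥
          (A.card : ℝ) * (B.card : ℝ) *
            Real.exp ((2 * Real.log 2 - δ) * (Real.log Q / Real.log (Real.log Q))) →
        (((A ×ˢ B).image (fun p => (p.1 : ℚ) / (p.2 : ℚ))).card : ℝ) ≥
          (A.card : ℝ) * (B.card : ℝ) *
            Real.exp (-ε * (Real.log Q / Real.log (Real.log Q))) := by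
  intro ε hε
  set x := min 1 (ε / 8) with hxdef
  have hx : 0 < x := by positivity
  have hx1 : x ≤ 1 := min_le_left _ _
  have hx2 : x ≤ ε / 8 := min_le_right _ _
  have hlx : Real.log x ≤ 0 := Real.log_nonpos hx.le hx1
  have hc : 0 < 16 - 56 * Real.log x := by linarith
  set δ := min (1 / 2) (ε / 2 / (16 - 56 * Real.log x)) with hδdef
  have hδ : 0 < δ := by positivity
  have hδ1 : δ ≤ 1 / 2 := min_le_left _ _
  have hδ2 : δ * (16 - 56 * Real.log x) ≤ ε / 2 := by
    rw [← le_div_iff₀ hc]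
    exact min_le_right _ _
  have hev : ∀ᶠ m : ℝ in Filter.atTop, 2 * m ^ 2 ≤ δ * Real.exp (δ * m) := by
    have := (isLittleO_pow_exp_pos_mul_atTop 2 hδ).bound (show 0 < δ / 2 by positivity)
    filter_upwards [this] with m hm
    rw [Real.norm_of_nonneg (by positivity), Real.norm_of_nonneg (by positivity)] at hm
    linarith
  obtain ⟨m₀, hm₀⟩ := Filter.eventually_atTop.1 hev
  refine ⟨δ, hδ, Real.exp (Real.exp (max m₀ 2)), ?_⟩
  intro Q hQ A B hAn hBn hA hB hE
  have hQp : 0 < Q := (Real.exp_pos _).trans_le hQ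
  have hl : Real.exp (max m₀ 2) ≤ Real.log Q := (Real.le_log_iff_exp_le hQp).2 hQ
  set l := Real.log Q with hldef
  have hlp : 0 < l := (Real.exp_pos _).trans_le hl
  have hm : max m₀ 2 ≤ Real.log l := (Real.le_log_iff_exp_le hlp).2 hl
  set m := Real.log l with hmdef
  have hm2 : 2 ≤ m := (le_max_right _ _).trans hm
  have hmp : 0 < m := by linarith
  have hmain := hm₀ m ((le_max_left _ _).trans hm)
  have hlm : Real.exp m = l := Real.exp_log hlp
  have hl4 : 4 ≤ l := by
    have h1 : Real.exp 2 ≤ l := hlm ▸ Real.exp_le_exp.2 hm2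
    have h2 : Real.exp 2 = Real.exp 1 * Real.exp 1 := by rw [← Real.exp_add]; norm_num
    nlinarith [Real.add_one_le_exp (1 : ℝ)]
  have hLp : 0 < l / m := by positivity
  have hδL : 1 ≤ δ * (l / m) := by
    rw [← mul_div_assoc, le_div_iff₀ hmp]
    have : Real.exp (δ * m) ≤ l := hlm ▸ Real.exp_le_exp.2 (by nlinarith)
    nlinarith
  have hlog2 : 0.69 < Real.log 2 := by linarith [Real.log_two_gt_d9]
  have hlog2' : Real.log 2 < 1 := by linarith [Real.log_two_lt_d9]
  set y := Real.exp ((1 - δ) * m) with hy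
  have hmem : ∀ n ∈ A ∪ B, 0 < n ∧ (n : ℝ) ≤ Q := by
    intro n hn
    rcases Finset.mem_union.1 hn with h | h
    · exact hA n h
    · exact hB n h
  have hrO : ∀ n ∈ A ∪ B, (rOm y n : ℝ) * ((1 - δ) * m) ≤ l := by
    intro n hn
    have h1 := (rOm_pow_le y (Real.exp_pos _).le (hmem n hn).1.ne').trans (hmem n hn).2
    rw [hy, ← Real.exp_nat_mul] at h1
    exact (Real.le_log_iff_exp_le hQp).2 h1
  have hr1 : ∀ n ∈ A ∪ B, (rOm y n : ℝ) ≤ (1 + 2 * δ) * (l / m) := by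
    intro n hn
    have h1 := hrO n hn
    rw [← mul_div_assoc, le_div_iff₀ hmp]
    have h0 : (0 : ℝ) ≤ rOm y n * m := by positivity
    nlinarith [mul_le_mul_of_nonneg_left h1 (show 0 ≤ 1 + 2 * δ by linarith),
      mul_nonneg h0 (show 0 ≤ δ * (1 - 2 * δ) by nlinarith)]
  have key := middle A B (fun a ha => (hA a ha).1) (fun b hb => (hB b hb).1) hAn hBn
    y (l / m) δ x ⌊l / Real.log 2⌋₊ hx hx1 hδL ?_ ?_ ?_ ?_ hE
  · refine le_trans ?_ key
    have : -ε * (l / m) ≤ -(δ * (16 - 56 * Real.log x) + 4 * x) * (l / m) := by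
      apply mul_le_mul_of_nonneg_right _ hLp.le
      linarith
    gcongr
  · have hD : ((⌊l / Real.log 2⌋₊ : ℕ) : ℝ) ≤ l / Real.log 2 := Nat.floor_le (by positivity)
    have hD2 : l / Real.log 2 ≤ 1.5 * l := by
      rw [div_le_iff₀ (by linarith)]
      nlinarith
    have h1 : (2 * ((⌊l / Real.log 2⌋₊ : ℕ) : ℝ) + 1) ≤ Real.exp (2 * m) := by
      rw [two_mul m, Real.exp_add, hlm]
      nlinarith
    calc _ ≤ Real.exp (2 * m) ^ ⌊y⌋₊ := by gcongr
      _ = Real.exp (⌊y⌋₊ * (2 * m)) := by rw [← Real.exp_nat_mul]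
      _ ≤ _ := by
        apply Real.exp_le_exp.2
        have h2 : (⌊y⌋₊ : ℝ) ≤ y := Nat.floor_le (Real.exp_pos _).le
        have h3 : y * Real.exp (δ * m) = l := by
          rw [hy, ← Real.exp_add, ← hlm]
          congr 1
          ring
        rw [← mul_div_assoc, le_div_iff₀ hmp, ← h3]
        have hyp : 0 < y := Real.exp_pos _
        calc (⌊y⌋₊ : ℝ) * (2 * m) * m ≤ y * (2 * m) * m := by gcongr
          _ = y * (2 * m ^ 2) := by ring
          _ ≤ y * (δ * Real.exp (δ * m)) := by gcongr
          _ = _ := by ring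
  · intro n hn p
    obtain ⟨hn0, hnQ⟩ := hmem n hn
    by_cases hp : p.Prime
    · apply Nat.le_floor
      rw [le_div_iff₀ (by linarith)]
      have h1 : 2 ^ n.factorization p ≤ n :=
        (Nat.pow_le_pow_left hp.two_le _).trans (Nat.ordProj_le p hn0.ne')
      have h2 : (2 : ℝ) ^ n.factorization p ≤ Q := le_trans (by exact_mod_cast h1) hnQ
      have h3 := Real.log_le_log (by positivity) h2
      rwa [Real.log_pow] at h3
    · simp [Nat.factorization_eq_zero_of_not_prime n hp]
  · intro n hn
    rw [← Real.rpow_natCast, Real.rpow_def_of_pos (by norm_num)]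
    apply Real.exp_le_exp.2
    have h1 := mul_le_mul_of_nonneg_left (hr1 n hn) (show 0 ≤ Real.log 2 by linarith)
    have h2 : Real.log 2 * (2 * δ * (l / m)) ≤ 1 * (2 * δ * (l / m)) := by gcongr
    linarith
  · intro n hn
    refine (hr1 n hn).trans ?_
    gcongr
    linarith
end

section
/- For every ε > 0 there exist δ > 0 and Q₀ such that for all real Q ≥ Q₀ and all nonempty finite sets A, B of positive integers contained in [1, Q]: if the product set satisfies |AB| ≤ |A|·|B|·exp((−2·log 2 + δ)·(log Q)/(log log Q)), then the quotient set satisfies |A/B| ≥ |A|·|B|·exp(−ε·(log Q)/(log log Q)). -/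
open Finset Pointwise

/-- A general bound for nonnegative multiplicative functions. -/
lemma mult_bound (f : ℕ → ℝ) (hf0 : ∀ n, 0 ≤ f n) (hf1 : f 1 = 1)
    (hfm : ∀ m n : ℕ, m.Coprime n → f (m * n) = f m * f n)
    (κ w y : ℝ) (hw : 0 ≤ w) (hy : 0 ≤ y)
    (h1 : ∀ p k : ℕ, p.Prime → 0 < k → y ≤ p → f (p ^ k) ≤ Real.exp (κ * (k * Real.log p)))
    (h2 : ∀ p k : ℕ, p.Prime → 0 < k → f (p ^ k) ≤ Real.exp w * Real.exp (κ * (k * Real.log p)))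
    (n : ℕ) (hn : n ≠ 0) : f n ≤ Real.exp (w * y + κ * Real.log n) := by
  have e1 : f n = ∏ p ∈ n.primeFactors, f (p ^ n.factorization p) := by
    rw [Nat.multiplicative_factorization f hfm hf1 hn]
    rfl
  have e2 : Real.log n = ∑ p ∈ n.primeFactors, (n.factorization p : ℝ) * Real.log p := by
    conv_lhs => rw [← Nat.prod_factorization_pow_eq_self hn]
    rw [Finsupp.prod, Nat.cast_prod, Real.log_prod]
    · simp
    · intro p hp
      have : p.Prime := Nat.prime_of_mem_primeFactors hp
      have := this.pos
      positivity
  have hcard : ((n.primeFactors.filter (fun p : ℕ => (p : ℝ) < y)).card : ℝ) ≤ y := by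
    have hsub : n.primeFactors.filter (fun p : ℕ => (p : ℝ) < y) ⊆ Finset.Icc 1 ⌊y⌋₊ := by
      intro p hp
      rw [mem_filter] at hp
      rw [mem_Icc]
      exact ⟨(Nat.prime_of_mem_primeFactors hp.1).pos, Nat.le_floor hp.2.le⟩
    have := card_le_card hsub
    rw [Nat.card_Icc] at this
    have h3 : (n.primeFactors.filter (fun p : ℕ => (p : ℝ) < y)).card ≤ ⌊y⌋₊ := by omega
    exact (Nat.cast_le.mpr h3).trans (Nat.floor_le hy)
  have e3 : ∑ p ∈ n.primeFactors, (if (p : ℝ) < y then w else 0) ≤ w * y := by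
    rw [← Finset.sum_filter, Finset.sum_const, nsmul_eq_mul, mul_comm]
    exact mul_le_mul_of_nonneg_left hcard hw
  calc f n = ∏ p ∈ n.primeFactors, f (p ^ n.factorization p) := e1
    _ ≤ ∏ p ∈ n.primeFactors, Real.exp ((if (p : ℝ) < y then w else 0) +
          κ * (n.factorization p * Real.log p)) := by
        apply Finset.prod_le_prod
        · intros; exact hf0 _
        · intro p hp
          have hpp := Nat.prime_of_mem_primeFactors hp
          have hk : 0 < n.factorization p :=
            hpp.factorization_pos_of_dvd hn (Nat.dvd_of_mem_primeFactors hp)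
          split_ifs with h
          · rw [Real.exp_add]; exact h2 p _ hpp hk
          · rw [zero_add]; exact h1 p _ hpp hk (not_lt.mp h)
    _ = Real.exp (∑ p ∈ n.primeFactors, (if (p : ℝ) < y then w else 0) + κ * Real.log n) := by
        rw [← Real.exp_sum, e2, Finset.mul_sum, Finset.sum_add_distrib]
    _ ≤ _ := Real.exp_le_exp.mpr (by linarith)

lemma asym (c θ η : ℝ) (hθ : θ < 1) (hη : 0 < η) :
    ∀ᶠ x : ℝ in Filter.atTop, c * x * Real.exp (θ * x) ≤ η * (Real.exp x / x) := by
  have h := (isLittleO_pow_exp_pos_mul_atTop 2 (b := 1 - θ) (by linarith)).def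
    (c := η / (|c| + 1)) (by positivity)
  filter_upwards [h, Filter.eventually_gt_atTop 0] with x hx hx0
  rw [Real.norm_of_nonneg (by positivity), Real.norm_of_nonneg (by positivity)] at hx
  rw [← mul_div_assoc, le_div_iff₀ hx0]
  have e : Real.exp x = Real.exp ((1 - θ) * x) * Real.exp (θ * x) := by
    rw [← Real.exp_add]; congr 1; ring
  rw [e]
  have h2 : (|c| + 1) * x ^ 2 ≤ η * Real.exp ((1 - θ) * x) := by
    rw [div_mul_eq_mul_div, le_div_iff₀ (by positivity)] at hx
    linarith
  have h3 : c * x ^ 2 ≤ η * Real.exp ((1 - θ) * x) :=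
    le_trans (mul_le_mul_of_nonneg_right (by linarith [le_abs_self c]) (by positivity)) h2
  have := mul_le_mul_of_nonneg_right h3 (Real.exp_pos (θ * x)).le
  nlinarith [this]

lemma master (c θ η : ℝ) (hc : 0 < c) (hθ : θ < 1) (hη : 0 < η) :
    ∀ᶠ x : ℝ in Filter.atTop, ∀ f : ℕ → ℝ, (∀ n, 0 ≤ f n) → f 1 = 1 →
      (∀ m n : ℕ, m.Coprime n → f (m * n) = f m * f n) →
      (∀ p k : ℕ, p.Prime → f (p ^ k) ≤ 2 * k + 1) →
      (∀ p k : ℕ, p.Prime → 0 < k → θ * x ≤ Real.log p →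
        f (p ^ k) ≤ Real.exp (c / x * (k * Real.log p))) →
      ∀ n : ℕ, n ≠ 0 → f n ≤ Real.exp (η * (Real.exp x / x) + c / x * Real.log n) := by
  filter_upwards [asym (2 / (c * Real.log 2)) θ η hθ hη, Filter.eventually_gt_atTop 0]
    with x hx hx0 f hf0 hf1 hfm hfb hfl n hn
  have hl2 : 0 < Real.log 2 := Real.log_pos (by norm_num)
  refine (mult_bound f hf0 hf1 hfm (c / x) (2 / (c * Real.log 2) * x) (Real.exp (θ * x))
    (by positivity) (by positivity) ?_ ?_ n hn).trans (Real.exp_le_exp.mpr (by linarith))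
  · intro p k hp hk hy
    apply hfl p k hp hk
    rw [Real.le_log_iff_exp_le (by exact_mod_cast hp.pos)]
    exact hy
  · intro p k hp hk
    refine (hfb p k hp).trans ?_
    have hlp : Real.log 2 ≤ Real.log p :=
      Real.log_le_log (by norm_num) (by exact_mod_cast hp.two_le)
    have hs : 0 ≤ c / x * (k * Real.log 2) := by positivity
    have hss : c / x * (k * Real.log 2) ≤ c / x * (k * Real.log p) := by gcongr
    set s := c / x * (k * Real.log 2) with hsdef
    set w := 2 / (c * Real.log 2) * x with hwdef
    have hw : 0 ≤ w := by positivity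
    have hws : w * s = 2 * k := by rw [hwdef, hsdef]; field_simp
    have hA : w + 1 ≤ Real.exp w := Real.add_one_le_exp w
    have hB : s + 1 ≤ Real.exp s := Real.add_one_le_exp s
    have hC : Real.exp s ≤ Real.exp (c / x * (k * Real.log p)) := Real.exp_le_exp.mpr hss
    calc (2 * k + 1 : ℝ) = w * s + 1 := by rw [hws]
      _ ≤ (w + 1) * (s + 1) := by nlinarith
      _ ≤ Real.exp w * Real.exp s := by gcongr
      _ ≤ _ := by gcongr

lemma tau_bound (η : ℝ) (hη : 0 < η) :
    ∀ᶠ x : ℝ in Filter.atTop, ∀ n : ℕ, n ≠ 0 → (n.divisors.card : ℝ) ≤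
      Real.exp (η * (Real.exp x / x) + Real.log 2 * (1 + η) / x * Real.log n) := by
  have hl2 : 0 < Real.log 2 := Real.log_pos (by norm_num)
  filter_upwards [master (Real.log 2 * (1 + η)) (1 / (1 + η)) η (by positivity)
    (by rw [div_lt_one (by positivity)]; linarith) hη, Filter.eventually_gt_atTop 0] with x hx hx0
  refine hx (fun n => (n.divisors.card : ℝ)) (fun n => by positivity) (by simp) ?_ ?_ ?_
  · intro m n h
    simp only [h.card_divisors_mul, Nat.cast_mul]
  · intro p k hp
    simp only [Nat.divisors_prime_pow hp, card_map, card_range]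
    push_cast
    linarith [(Nat.cast_nonneg k : (0 : ℝ) ≤ k)]
  · intro p k hp hk h
    simp only [Nat.divisors_prime_pow hp, card_map, card_range]
    have h1 : ((k + 1 : ℕ) : ℝ) ≤ 2 ^ k := by exact_mod_cast Nat.lt_two_pow_self
    have h2 : (2 : ℝ) ^ k = Real.exp (k * Real.log 2) := by
      rw [mul_comm, Real.exp_mul, Real.exp_log (by norm_num), Real.rpow_natCast]
    refine h1.trans (h2.le.trans (Real.exp_le_exp.mpr ?_))
    have h3 : x ≤ (1 + η) * Real.log p := by
      rw [div_mul_eq_mul_div, div_le_iff₀ (by positivity)] at h; linarith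
    rw [div_mul_eq_mul_div, le_div_iff₀ hx0]
    have : 0 ≤ (k : ℝ) * Real.log 2 := by positivity
    nlinarith [mul_le_mul_of_nonneg_left h3 this]

lemma tausq_bound (η : ℝ) (hη : 0 < η) :
    ∀ᶠ x : ℝ in Filter.atTop, ∀ n : ℕ, n ≠ 0 → ((n ^ 2).divisors.card : ℝ) ≤
      Real.exp (η * (Real.exp x / x) + Real.log 3 * (1 + η) / x * Real.log n) := by
  have hl2 : 0 < Real.log 3 := Real.log_pos (by norm_num)
  filter_upwards [master (Real.log 3 * (1 + η)) (1 / (1 + η)) η (by positivity)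
    (by rw [div_lt_one (by positivity)]; linarith) hη, Filter.eventually_gt_atTop 0] with x hx hx0
  refine hx (fun n => ((n ^ 2).divisors.card : ℝ)) (fun n => by positivity) (by simp) ?_ ?_ ?_
  · intro m n h
    simp only [mul_pow, (h.pow 2 2).card_divisors_mul, Nat.cast_mul]
  · intro p k hp
    simp only [← pow_mul, Nat.divisors_prime_pow hp, card_map, card_range]
    push_cast
    linarith [(Nat.cast_nonneg k : (0 : ℝ) ≤ k)]
  · intro p k hp hk h
    simp only [← pow_mul, Nat.divisors_prime_pow hp, card_map, card_range]
    have h1 : ((k * 2 + 1 : ℕ) : ℝ) ≤ 3 ^ k := by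
      have : k * 2 + 1 ≤ 3 ^ k := by
        clear hk
        induction k with
        | zero => simp
        | succ k ih => rw [pow_succ]; omega
      exact_mod_cast this
    have h2 : (3 : ℝ) ^ k = Real.exp (k * Real.log 3) := by
      rw [mul_comm, Real.exp_mul, Real.exp_log (by norm_num), Real.rpow_natCast]
    refine h1.trans (h2.le.trans (Real.exp_le_exp.mpr ?_))
    have h3 : x ≤ (1 + η) * Real.log p := by
      rw [div_mul_eq_mul_div, div_le_iff₀ (by positivity)] at h; linarith
    rw [div_mul_eq_mul_div, le_div_iff₀ hx0]
    have : 0 ≤ (k : ℝ) * Real.log 3 := by positivity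
    nlinarith [mul_le_mul_of_nonneg_left h3 this]

/-- Rankin-type bound. -/
lemma rankin_bound (u L η : ℝ) (hu : 0 < u) (hL : 0 < L) (hη : 0 < η)
    (hLu : 1 ≤ Real.exp u * (1 - Real.exp (-(L / 2)))) :
    ∀ᶠ x : ℝ in Filter.atTop, ∀ n : ℕ, n ≠ 0 →
      ∑ d ∈ n.divisors, Real.exp (-(L / x) * Real.log d) ≤
      Real.exp (η * (Real.exp x / x) + 2 * u / x * Real.log n) := by
  filter_upwards [master (2 * u) (1 / 2) η (by positivity) (by norm_num) hη,
    Filter.eventually_gt_atTop 0] with x hx hx0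
  have key : ∀ p k : ℕ, p.Prime → ∑ d ∈ (p ^ k).divisors, Real.exp (-(L / x) * Real.log d) =
      ∑ j ∈ range (k + 1), (Real.exp (-(L / x) * Real.log p)) ^ j := by
    intro p k hp
    rw [Nat.sum_divisors_prime_pow hp]
    refine sum_congr rfl fun j _ => ?_
    rw [← Real.exp_nat_mul]
    push_cast
    rw [Real.log_pow]
    congr 1; ring
  refine hx (fun n => ∑ d ∈ n.divisors, Real.exp (-(L / x) * Real.log d))
    (fun n => by positivity) (by simp) ?_ ?_ ?_
  · intro m n h
    have hinj : Set.InjOn (fun q : ℕ × ℕ => q.1 * q.2)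
        (m.divisors ×ˢ n.divisors : Finset (ℕ × ℕ)) := by
      exact h.mul_injOn_divisors
    rw [Nat.divisors_mul, Finset.mul_def, Finset.sum_image hinj, Finset.sum_mul_sum,
      ← Finset.sum_product']
    refine sum_congr rfl fun q hq => ?_
    rw [mem_product] at hq
    have q1 : (q.1 : ℝ) ≠ 0 := by exact_mod_cast (Nat.pos_of_mem_divisors hq.1).ne'
    have q2 : (q.2 : ℝ) ≠ 0 := by exact_mod_cast (Nat.pos_of_mem_divisors hq.2).ne'
    rw [← Real.exp_add, Nat.cast_mul, Real.log_mul q1 q2]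
    congr 1; ring
  · intro p k hp
    simp only [key p k hp]
    have : ∀ j ∈ range (k + 1), (Real.exp (-(L / x) * Real.log p)) ^ j ≤ 1 := by
      intro j _
      apply pow_le_one₀ (Real.exp_pos _).le
      rw [Real.exp_le_one_iff]
      have : 0 ≤ Real.log p := Real.log_natCast_nonneg p
      have : 0 ≤ L / x * Real.log p := by positivity
      linarith
    have := sum_le_sum this
    simp at this
    simp only [neg_mul]
    linarith [(Nat.cast_nonneg k : (0 : ℝ) ≤ k)]
  · intro p k hp hk h
    simp only [key p k hp]
    set z := Real.exp (-(L / x) * Real.log p) with hz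
    have hz0 : 0 < z := Real.exp_pos _
    have hz1 : z ≤ Real.exp (-(L / 2)) := by
      apply Real.exp_le_exp.mpr
      have : L / x * (1 / 2 * x) ≤ L / x * Real.log p := by gcongr
      have e : L / x * (1 / 2 * x) = L / 2 := by field_simp
      linarith
    have hz2 : Real.exp (-(L / 2)) < 1 := by rw [Real.exp_lt_one_iff]; linarith
    have hgeo : (∑ j ∈ range (k + 1), z ^ j) * (1 - z) ≤ 1 := by
      have := geom_sum_mul_neg z (k + 1)
      rw [this]
      have : 0 < z ^ (k + 1) := by positivity
      linarith
    have hs : ∑ j ∈ range (k + 1), z ^ j ≤ Real.exp u := by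
      have h5 : 1 ≤ Real.exp u * (1 - z) := hLu.trans (by gcongr)
      have h6 : 0 < 1 - z := by linarith
      exact le_of_mul_le_mul_right (hgeo.trans h5) h6
    refine hs.trans (Real.exp_le_exp.mpr ?_)
    rw [div_mul_eq_mul_div, le_div_iff₀ hx0]
    have hk1 : (1 : ℝ) ≤ k := by exact_mod_cast hk
    have hlp : 0 ≤ Real.log p := by linarith
    have : x ≤ 2 * (k * Real.log p) := by nlinarith
    nlinarith

lemma comb1 (A B : Finset ℕ) (hA : ∀ a ∈ A, 0 < a) (hB : ∀ b ∈ B, 0 < b) (R : ℝ) (hR : 0 ≤ R)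
    (h : (((A ×ˢ B).image (fun p => p.1 * p.2)).card : ℝ) * R ≤ (A.card : ℝ) * B.card / 2) :
    (A.card : ℝ) * B.card / 2 ≤
      (((A ×ˢ B).filter (fun p => R ≤ ((p.1 * p.2).divisors.card : ℝ))).card : ℝ) := by
  set P := A ×ˢ B with hP
  have hPc : (P.card : ℝ) = A.card * B.card := by rw [hP, card_product]; push_cast; rfl
  have hsplit := card_filter_add_card_filter_not (s := P)
    (fun p : ℕ × ℕ => R ≤ ((p.1 * p.2).divisors.card : ℝ))
  set C := P.filter (fun p => ¬ R ≤ ((p.1 * p.2).divisors.card : ℝ)) with hC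
  have h1 : C.card ≤ ⌊R⌋₊ * (C.image (fun p => p.1 * p.2)).card := by
    apply card_le_mul_card_image
    intro n hn
    rw [mem_image] at hn
    obtain ⟨q, hq, rfl⟩ := hn
    have hq2 := (mem_filter.mp hq).2
    have hqP := mem_product.mp (mem_filter.mp hq).1
    refine le_trans ?_ (Nat.le_floor (not_le.mp hq2).le)
    apply card_le_card_of_injOn (fun p => p.1)
    · intro p hp
      simp only [coe_filter, Set.mem_ofPred_eq] at hp
      simp only [mem_coe, Nat.mem_divisors]
      refine ⟨⟨p.2, hp.2.symm⟩, ?_⟩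
      have := hA _ hqP.1
      have := hB _ hqP.2
      positivity
    · intro p hp p' hp' hpp
      simp only [coe_filter, Set.mem_ofPred_eq] at hp hp' hpp
      have h0 : 0 < p.1 := hA _ (mem_product.mp (mem_filter.mp hp.1).1).1
      ext
      · exact hpp
      · have : p.1 * p.2 = p.1 * p'.2 := by rw [hp.2, hpp, hp'.2]
        exact Nat.eq_of_mul_eq_mul_left h0 this
  have h2 : (C.image (fun p => p.1 * p.2)).card ≤ (P.image (fun p => p.1 * p.2)).card :=
    card_le_card (image_subset_image (filter_subset _ _))
  have h3 : (C.card : ℝ) ≤ (P.image (fun p => p.1 * p.2)).card * R := by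
    calc (C.card : ℝ) ≤ (⌊R⌋₊ : ℝ) * ((C.image (fun p => p.1 * p.2)).card : ℝ) := by
          exact_mod_cast h1
      _ ≤ R * ((P.image (fun p => p.1 * p.2)).card : ℝ) := by
          gcongr
          exact Nat.floor_le hR
      _ = _ := mul_comm _ _
  have h4 : ((P.filter (fun p => R ≤ ((p.1 * p.2).divisors.card : ℝ))).card : ℝ) + C.card
      = P.card := by exact_mod_cast hsplit
  linarith

lemma sumG (A G : Finset ℕ) (hA : ∀ a ∈ A, 0 < a) (t T : ℝ)
    (hG : ∀ g ∈ G, Real.log (g : ℝ) ≤ t)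
    (hT : ∀ a ∈ A, ((a.divisors.filter (fun g : ℕ => Real.log (g : ℝ) ≤ t)).card : ℝ) ≤ T) :
    ∑ g ∈ G, ((A.filter (fun a => g ∣ a)).card : ℝ) ≤ A.card * T := by
  have h := sum_card_bipartiteAbove_eq_sum_card_bipartiteBelow (s := G) (t := A)
    (fun g a : ℕ => g ∣ a)
  have h' : ∑ g ∈ G, ((A.filter (fun a => g ∣ a)).card : ℝ) =
      ∑ a ∈ A, ((G.filter (fun g => g ∣ a)).card : ℝ) := by exact_mod_cast h
  rw [h', ← nsmul_eq_mul]
  apply sum_le_card_nsmul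
  intro a ha
  refine le_trans ?_ (hT a ha)
  apply Nat.cast_le.mpr
  apply card_le_card
  intro g hg
  rw [mem_filter] at hg ⊢
  exact ⟨Nat.mem_divisors.mpr ⟨hg.2, (hA a ha).ne'⟩, hG g hg.1⟩

lemma comb2 (A B : Finset ℕ) (hA : ∀ a ∈ A, 0 < a) (hB : ∀ b ∈ B, 0 < b) (hAne : A.Nonempty)
    (t T : ℝ) (hT0 : 0 < T)
    (hTA : ∀ a ∈ A, ((a.divisors.filter (fun g : ℕ => Real.log (g : ℝ) ≤ t)).card : ℝ) ≤ T)
    (hTB : ∀ a ∈ B, ((a.divisors.filter (fun g : ℕ => Real.log (g : ℝ) ≤ t)).card : ℝ) ≤ T)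
    (S : Finset (ℕ × ℕ)) (hS : S ⊆ A ×ˢ B)
    (hSg : ∀ p ∈ S, Real.log ((Nat.gcd p.1 p.2 : ℕ) : ℝ) ≤ t)
    (hSc : (A.card : ℝ) * B.card / 2 ≤ S.card) :
    (A.card : ℝ) * B.card / (16 * T ^ 2) ≤
      (((A ×ˢ B).image (fun p => (p.1 : ℚ) / (p.2 : ℚ))).card : ℝ) := by
  set X : ℝ := (((A ×ˢ B).image (fun p => (p.1 : ℚ) / (p.2 : ℚ))).card : ℝ) with hX
  set G := S.image (fun p => Nat.gcd p.1 p.2) with hG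
  have hGt : ∀ g ∈ G, Real.log (g : ℝ) ≤ t := by
    intro g hg
    obtain ⟨p, hp, rfl⟩ := mem_image.mp hg
    exact hSg p hp
  have sA := sumG A G hA t T hGt hTA
  have sB := sumG B G hB t T hGt hTB
  have hAc : (0 : ℝ) < A.card := by exact_mod_cast hAne.card_pos
  have hScard : (S.card : ℝ) =
      ∑ g ∈ G, ((S.filter (fun p => Nat.gcd p.1 p.2 = g)).card : ℝ) := by
    exact_mod_cast card_eq_sum_card_image (fun p : ℕ × ℕ => Nat.gcd p.1 p.2) S
  have hX0 : 0 ≤ X := by positivity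
  have bound : ∀ g ∈ G, ((S.filter (fun p => Nat.gcd p.1 p.2 = g)).card : ℝ) ≤
      A.card / (4 * T) * ((B.filter (fun a => g ∣ a)).card : ℝ) +
      4 * T / A.card * X * ((A.filter (fun a => g ∣ a)).card : ℝ) := by
    intro g _
    set α : ℝ := ((A.filter (fun a => g ∣ a)).card : ℝ)
    set β : ℝ := ((B.filter (fun a => g ∣ a)).card : ℝ)
    have hα : 0 ≤ α := by positivity
    have hβ : 0 ≤ β := by positivity
    by_cases hc : α ≤ A.card / (4 * T)
    · have h1 : ((S.filter (fun p => Nat.gcd p.1 p.2 = g)).card : ℝ) ≤ α * β := by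
        have : (S.filter (fun p => Nat.gcd p.1 p.2 = g)) ⊆
            (A.filter (fun a => g ∣ a)) ×ˢ (B.filter (fun a => g ∣ a)) := by
          intro p hp
          obtain ⟨hp1, rfl⟩ := mem_filter.mp hp
          have := mem_product.mp (hS hp1)
          rw [mem_product, mem_filter, mem_filter]
          exact ⟨⟨this.1, Nat.gcd_dvd_left _ _⟩, ⟨this.2, Nat.gcd_dvd_right _ _⟩⟩
        have := card_le_card this
        rw [card_product] at this
        have h' := (Nat.cast_le (α := ℝ)).mpr this
        rw [Nat.cast_mul] at h'
        exact h'
      have h2 : α * β ≤ A.card / (4 * T) * β := by gcongr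
      have h3 : 0 ≤ 4 * T / A.card * X * α := by positivity
      linarith
    · have h1 : ((S.filter (fun p => Nat.gcd p.1 p.2 = g)).card : ℝ) ≤ X := by
        apply Nat.cast_le.mpr
        apply card_le_card_of_injOn (fun p => (p.1 : ℚ) / (p.2 : ℚ))
        · intro p hp
          have hp' := mem_filter.mp (mem_coe.mp hp)
          exact mem_coe.mpr (mem_image_of_mem _ (hS hp'.1))
        · intro p hp q hq hpq
          have hp' := mem_filter.mp (mem_coe.mp hp)
          have hq' := mem_filter.mp (mem_coe.mp hq)
          have hpm := mem_product.mp (hS hp'.1)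
          have hqm := mem_product.mp (hS hq'.1)
          have p1 := hA _ hpm.1
          have p2 := hB _ hpm.2
          have q1 := hA _ hqm.1
          have q2 := hB _ hqm.2
          simp only at hpq
          rw [div_eq_div_iff (by positivity) (by positivity)] at hpq
          have e : p.1 * q.2 = q.1 * p.2 := by exact_mod_cast hpq
          have e1 : p.1 = q.1 := by
            have a1 : Nat.gcd (p.1 * q.1) (p.1 * q.2) = p.1 * g := by
              rw [Nat.gcd_mul_left, hq'.2]
            have a2 : Nat.gcd (q.1 * p.1) (q.1 * p.2) = q.1 * g := by
              rw [Nat.gcd_mul_left, hp'.2]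
            have g0 : 0 < g := by rw [← hp'.2]; exact Nat.gcd_pos_of_pos_left _ p1
            apply Nat.eq_of_mul_eq_mul_right g0
            rw [← a1, ← a2, e, mul_comm p.1 q.1]
          ext
          · exact e1
          · rw [e1] at e
            exact (Nat.eq_of_mul_eq_mul_left q1 e).symm
      have h2 : 1 ≤ 4 * T / A.card * α := by
        have := (not_le.mp hc).le
        rw [div_le_iff₀ (by positivity)] at this
        rw [div_mul_eq_mul_div, le_div_iff₀ hAc]
        linarith
      have h3 : 0 ≤ A.card / (4 * T) * β := by positivity
      nlinarith [mul_le_mul_of_nonneg_left h2 hX0]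
  have tot := sum_le_sum bound
  rw [← hScard, sum_add_distrib, ← mul_sum, ← mul_sum] at tot
  have t1 : A.card / (4 * T) * ∑ g ∈ G, ((B.filter (fun a => g ∣ a)).card : ℝ) ≤
      A.card / (4 * T) * (B.card * T) := by gcongr
  have t2 : 4 * T / A.card * X * ∑ g ∈ G, ((A.filter (fun a => g ∣ a)).card : ℝ) ≤
      4 * T / A.card * X * (A.card * T) := by gcongr
  have e1 : A.card / (4 * T) * (B.card * T) = (A.card : ℝ) * B.card / 4 := by field_simp
  have e2 : 4 * T / A.card * X * (A.card * T) = 4 * T ^ 2 * X := by field_simp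
  rw [div_le_iff₀ (by positivity)]
  linarith

lemma gcd_small (δ x M lQ : ℝ) (hδ : 0 < δ) (hx0 : 0 < x) (hM : M = lQ / x)
    (hM2 : Real.log 2 ≤ δ * M) (hM0 : 0 < M)
    (htau : ∀ n : ℕ, n ≠ 0 → (n.divisors.card : ℝ) ≤
      Real.exp (δ * M + Real.log 2 * (1 + δ) / x * Real.log n))
    (htausq : ∀ n : ℕ, n ≠ 0 → ((n ^ 2).divisors.card : ℝ) ≤
      Real.exp (δ * M + Real.log 3 * (1 + δ) / x * Real.log n))
    (a b : ℕ) (ha : 0 < a) (hb : 0 < b) (haQ : Real.log a ≤ lQ) (hbQ : Real.log b ≤ lQ)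
    (hR : Real.exp ((2 * Real.log 2 - δ) * M) / 2 ≤ ((a * b).divisors.card : ℝ)) :
    Real.log ((Nat.gcd a b : ℕ) : ℝ) ≤ 28 * δ * lQ := by
  set g := Nat.gcd a b with hg
  have hg0 : 0 < g := Nat.gcd_pos_of_pos_left _ ha
  obtain ⟨c, hc⟩ : g ∣ a := Nat.gcd_dvd_left a b
  obtain ⟨d, hd⟩ : g ∣ b := Nat.gcd_dvd_right a b
  have hc0 : 0 < c := by
    rcases Nat.eq_zero_or_pos c with h | h
    · rw [h] at hc; omega
    · exact h
  have hd0 : 0 < d := by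
    rcases Nat.eq_zero_or_pos d with h | h
    · rw [h] at hd; omega
    · exact h
  clear_value g
  have gR : (g : ℝ) ≠ 0 := by positivity
  have la : Real.log a = Real.log g + Real.log c := by
    rw [hc, Nat.cast_mul, Real.log_mul gR (by positivity)]
  have lb : Real.log b = Real.log g + Real.log d := by
    rw [hd, Nat.cast_mul, Real.log_mul gR (by positivity)]
  have hlg : 0 ≤ Real.log g := Real.log_natCast_nonneg g
  have sub : ∀ m n : ℕ, ((m * n).divisors.card : ℝ) ≤ m.divisors.card * n.divisors.card := by
    intro m n
    rw [Nat.divisors_mul]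
    exact_mod_cast Finset.card_mul_le
  have e : a * b = g ^ 2 * (c * d) := by rw [hc, hd]; ring
  have l2 : 0 < Real.log 2 := Real.log_pos (by norm_num)
  have up : ((a * b).divisors.card : ℝ) ≤
      Real.exp (δ * M + Real.log 3 * (1 + δ) / x * Real.log g) *
      (Real.exp (δ * M + Real.log 2 * (1 + δ) / x * Real.log c) *
       Real.exp (δ * M + Real.log 2 * (1 + δ) / x * Real.log d)) := by
    rw [e]
    refine (sub _ _).trans ?_
    have h1 := htausq g hg0.ne'
    have h2 := htau c hc0.ne'
    have h3 := htau d hd0.ne'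
    have h4 := sub c d
    have h5 := h4.trans (mul_le_mul h2 h3 (Nat.cast_nonneg _) (Real.exp_pos _).le)
    exact mul_le_mul h1 h5 (Nat.cast_nonneg _) (Real.exp_pos _).le
  have lo : Real.exp ((2 * Real.log 2 - δ) * M) / 2 =
      Real.exp ((2 * Real.log 2 - δ) * M - Real.log 2) := by
    rw [Real.exp_sub, Real.exp_log (by norm_num)]
  rw [lo] at hR
  have h := hR.trans up
  rw [← Real.exp_add, ← Real.exp_add, Real.exp_le_exp] at h
  have hk : 0 < Real.log 2 * (1 + δ) / x := by positivity
  have hcc : Real.log 2 * (1 + δ) / x * Real.log c ≤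
      Real.log 2 * (1 + δ) / x * (lQ - Real.log g) := by
    apply mul_le_mul_of_nonneg_left _ hk.le; linarith
  have hdd : Real.log 2 * (1 + δ) / x * Real.log d ≤
      Real.log 2 * (1 + δ) / x * (lQ - Real.log g) := by
    apply mul_le_mul_of_nonneg_left _ hk.le; linarith
  have f1 : Real.log 2 * (1 + δ) / x * (lQ - Real.log g) =
      Real.log 2 * (1 + δ) * (M - Real.log g / x) := by rw [hM]; field_simp
  have f2 : Real.log 3 * (1 + δ) / x * Real.log g =
      Real.log 3 * (1 + δ) * (Real.log g / x) := by field_simp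
  rw [f1] at hcc hdd
  rw [f2] at h
  have hs0 : 0 ≤ Real.log g / x := by positivity
  have h43 : 1 / 4 ≤ 2 * Real.log 2 - Real.log 3 := by
    have := Real.one_sub_inv_le_log_of_pos (x := 4 / 3) (by norm_num)
    rw [Real.log_div (by norm_num) (by norm_num), show (4 : ℝ) = 2 ^ 2 by norm_num,
      Real.log_pow] at this
    norm_num at this ⊢
    linarith
  have hsM : Real.log g / x ≤ 28 * δ * M := by
    set s := Real.log g / x
    have k1 : (1 + δ) * (2 * Real.log 2 - Real.log 3) * s ≤
        5 * δ * M + 2 * δ * Real.log 2 * M := by nlinarith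
    have k2 : 1 / 4 * s ≤ (1 + δ) * (2 * Real.log 2 - Real.log 3) * s := by
      apply mul_le_mul_of_nonneg_right _ hs0
      nlinarith
    have k3 : 2 * δ * Real.log 2 * M ≤ 2 * δ * M := by
      have : δ * M * Real.log 2 ≤ δ * M * 1 :=
        mul_le_mul_of_nonneg_left (by linarith [Real.log_two_lt_d9]) (by positivity)
      linarith
    linarith
  rw [div_le_iff₀ hx0] at hsM
  have : 28 * δ * M * x = 28 * δ * lQ := by rw [hM]; field_simp
  linarith

lemma count_small (u L δ x M lQ : ℝ) (hu : 0 < u) (hL : 0 < L) (hx0 : 0 < x) (hM : M = lQ / x)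
    (hrank : ∀ n : ℕ, n ≠ 0 → ∑ d ∈ n.divisors, Real.exp (-(L / x) * Real.log d) ≤
      Real.exp (δ * M + 2 * u / x * Real.log n))
    (a : ℕ) (ha : 0 < a) (haQ : Real.log a ≤ lQ) :
    ((a.divisors.filter (fun g : ℕ => Real.log (g : ℝ) ≤ 28 * δ * lQ)).card : ℝ) ≤
      Real.exp (28 * δ * L * M + δ * M + 2 * u * M) := by
  have h1 : ((a.divisors.filter (fun g : ℕ => Real.log (g : ℝ) ≤ 28 * δ * lQ)).card : ℝ) ≤
      ∑ d ∈ a.divisors, Real.exp (28 * δ * L * M) * Real.exp (-(L / x) * Real.log d) := by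
    rw [Finset.card_eq_sum_ones, Nat.cast_sum]
    refine le_trans (Finset.sum_le_sum (g := fun d : ℕ =>
      Real.exp (28 * δ * L * M) * Real.exp (-(L / x) * Real.log d)) ?_)
      (Finset.sum_le_sum_of_subset_of_nonneg (filter_subset _ _) ?_)
    · intro d hd
      rw [mem_filter] at hd
      rw [← Real.exp_add, Nat.cast_one, Real.one_le_exp_iff]
      have : L / x * Real.log d ≤ L / x * (28 * δ * lQ) :=
        mul_le_mul_of_nonneg_left hd.2 (by positivity)
      have e : L / x * (28 * δ * lQ) = 28 * δ * L * M := by rw [hM]; field_simp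
      linarith
    · intros; positivity
  rw [← mul_sum] at h1
  have h2 := mul_le_mul_of_nonneg_left (hrank a ha.ne') (Real.exp_pos (28 * δ * L * M)).le
  refine h1.trans (h2.trans ?_)
  rw [← Real.exp_add, Real.exp_le_exp]
  have : 2 * u / x * Real.log a ≤ 2 * u / x * lQ :=
    mul_le_mul_of_nonneg_left haQ (by positivity)
  have e : 2 * u / x * lQ = 2 * u * M := by rw [hM]; field_simp
  linarith

/-- For every ε > 0 there exist δ > 0 and Q₀ such that for all real Q ≥ Q₀ and all
nonempty finite sets A, B of positive integers contained in [1, Q]: if the product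
set satisfies |AB| ≤ |A|·|B|·exp((−2·log 2 + δ)·(log Q)/(log log Q)), then the
quotient set satisfies |A/B| ≥ |A|·|B|·exp(−ε·(log Q)/(log log Q)). -/
theorem stmt_14 :
    ∀ ε : ℝ, 0 < ε → ∃ δ : ℝ, 0 < δ ∧ ∃ Q₀ : ℝ, ∀ Q : ℝ, Q₀ ≤ Q →
      ∀ A B : Finset ℕ, A.Nonempty → B.Nonempty →
        (∀ a ∈ A, 0 < a ∧ (a : ℝ) ≤ Q) →
        (∀ b ∈ B, 0 < b ∧ (b : ℝ) ≤ Q) →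
        (((A ×ˢ B).image (fun p => p.1 * p.2)).card : ℝ) ≤
          (A.card : ℝ) * (B.card : ℝ) *
            Real.exp ((-2 * Real.log 2 + δ) * (Real.log Q / Real.log (Real.log Q))) →
        (((A ×ˢ B).image (fun p => (p.1 : ℚ) / (p.2 : ℚ))).card : ℝ) ≥
          (A.card : ℝ) * (B.card : ℝ) *
            Real.exp (-ε * (Real.log Q / Real.log (Real.log Q))) := by
  intro ε hε
  obtain ⟨u, hu⟩ : ∃ u : ℝ, u = ε / 16 := ⟨_, rfl⟩
  have hu0 : 0 < u := by rw [hu]; positivity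
  have hex : Real.exp (-u) < 1 := by rw [Real.exp_lt_one_iff]; linarith
  obtain ⟨L, hLdef⟩ : ∃ L : ℝ, L = -2 * Real.log (1 - Real.exp (-u)) := ⟨_, rfl⟩
  have hL : 0 < L := by
    have := Real.log_neg (x := 1 - Real.exp (-u)) (by linarith) (by linarith [Real.exp_pos (-u)])
    rw [hLdef]; linarith
  have hLu : 1 ≤ Real.exp u * (1 - Real.exp (-(L / 2))) := by
    have e : -(L / 2) = Real.log (1 - Real.exp (-u)) := by rw [hLdef]; ring
    rw [e, Real.exp_log (by linarith), sub_sub_cancel, ← Real.exp_add]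
    simp
  obtain ⟨δ, hδdef⟩ : ∃ δ : ℝ, δ = ε / (8 * (28 * L + 1)) := ⟨_, rfl⟩
  have hδ : 0 < δ := by rw [hδdef]; positivity
  have hδε : 28 * δ * L + δ = ε / 8 := by rw [hδdef]; field_simp
  refine ⟨δ, hδ, ?_⟩
  have hMt : Filter.Tendsto (fun x : ℝ => Real.exp x / x) Filter.atTop Filter.atTop := by
    simpa using Real.tendsto_exp_div_pow_atTop 1
  have ev := ((tau_bound δ hδ).and ((tausq_bound δ hδ).and
    ((rankin_bound u L δ hu0 hL hδ hLu).and ((hMt.eventually_ge_atTop (Real.log 2 / δ)).and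
    ((hMt.eventually_ge_atTop (Real.log 16 / (ε / 2))).and (Filter.eventually_gt_atTop 0))))))
  have ev2 := (Real.tendsto_log_atTop.comp Real.tendsto_log_atTop).eventually ev
  obtain ⟨Q₀, hQ₀⟩ := Filter.eventually_atTop.mp
    (ev2.and ((Real.tendsto_log_atTop.eventually_gt_atTop 0).and (Filter.eventually_gt_atTop 0)))
  refine ⟨Q₀, ?_⟩
  intro Q hQ A B hA hB hAQ hBQ hAB
  obtain ⟨⟨htau, htausq, hrank, hM2, hM16, hx0⟩, hlQ, hQ0⟩ := hQ₀ Q hQ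
  simp only [Function.comp_apply, Real.exp_log hlQ] at htau htausq hrank hM2 hM16 hx0
  obtain ⟨M, hM⟩ : ∃ M : ℝ, M = Real.log Q / Real.log (Real.log Q) := ⟨_, rfl⟩
  rw [← hM] at hAB hM2 hM16 ⊢
  rw [← hM] at htau htausq hrank
  have hM0 : 0 < M := by rw [hM]; positivity
  rw [div_le_iff₀ hδ] at hM2
  rw [div_le_iff₀ (by positivity)] at hM16
  have hA0 : ∀ a ∈ A, 0 < a := fun a ha => (hAQ a ha).1
  have hB0 : ∀ a ∈ B, 0 < a := fun a ha => (hBQ a ha).1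
  have hAl : ∀ a ∈ A, Real.log a ≤ Real.log Q := fun a ha =>
    Real.log_le_log (by exact_mod_cast hA0 a ha) (hAQ a ha).2
  have hBl : ∀ a ∈ B, Real.log a ≤ Real.log Q := fun a ha =>
    Real.log_le_log (by exact_mod_cast hB0 a ha) (hBQ a ha).2
  have c1 := comb1 A B hA0 hB0 (Real.exp ((2 * Real.log 2 - δ) * M) / 2) (by positivity) (by
    refine (mul_le_mul_of_nonneg_right hAB (by positivity)).trans (le_of_eq ?_)
    have : Real.exp ((-2 * Real.log 2 + δ) * M) * Real.exp ((2 * Real.log 2 - δ) * M) = 1 := by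
      rw [← Real.exp_add, ← Real.exp_zero]; congr 1; ring
    linear_combination (A.card * B.card / 2 : ℝ) * this)
  have c2 := comb2 A B hA0 hB0 hA (28 * δ * Real.log Q)
    (Real.exp (28 * δ * L * M + δ * M + 2 * u * M)) (Real.exp_pos _)
    (fun a ha => count_small u L δ _ M _ hu0 hL hx0 hM hrank a (hA0 a ha) (hAl a ha))
    (fun a ha => count_small u L δ _ M _ hu0 hL hx0 hM hrank a (hB0 a ha) (hBl a ha))
    _ (filter_subset _ _) (by
      intro p hp
      rw [mem_filter, mem_product] at hp
      exact gcd_small δ _ M _ hδ hx0 hM (by linarith) hM0 htau htausq p.1 p.2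
        (hA0 _ hp.1.1) (hB0 _ hp.1.2) (hAl _ hp.1.1) (hBl _ hp.1.2) hp.2) c1
  refine ge_iff_le.mpr (le_trans ?_ c2)
  rw [le_div_iff₀ (by positivity), mul_assoc]
  refine mul_le_of_le_one_right (by positivity) ?_
  have e16 : (16 : ℝ) = Real.exp (Real.log 16) := (Real.exp_log (by norm_num)).symm
  rw [e16, ← Real.exp_nat_mul, ← Real.exp_add, ← Real.exp_add, Real.exp_le_one_iff]
  push_cast
  have k : 28 * δ * L * M + δ * M + 2 * u * M = ε / 4 * M := by
    have : (28 * δ * L + δ) * M = ε / 8 * M := by rw [hδε]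
    rw [hu]; linarith
  rw [k]
  linarith
end

section
/- For every δ with 0 < δ ≤ 1/2 and every η > 0 there exists Q₀ such that for all real Q ≥ Q₀ and all finite sets A, B of positive integers contained in [1, Q], the number of quadruples (a₁, b₁, a₂, b₂) ∈ A × B × A × B with a₁·b₂ = a₂·b₁, gcd(a₁, b₁) ≤ Q^δ, and gcd(a₂, b₂) ≤ Q^δ is at most |A|·|B|·exp((2·(δ·log(1/δ) + (1−δ)·log(1/(1−δ))) + η)·(log Q)/(log log Q)). -/
open Finset

/-- The Rankin sum over the divisors of `n`. -/
noncomputable def rankF (s : ℝ) (n : ℕ) : ℝ := ∑ d ∈ n.divisors, (d : ℝ) ^ (-s)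

lemma rankF_nonneg (s : ℝ) (n : ℕ) : 0 ≤ rankF s n :=
  Finset.sum_nonneg fun d _ => Real.rpow_nonneg (Nat.cast_nonneg d) _

open Pointwise in
lemma rankF_mul_le (s : ℝ) (m n : ℕ) : rankF s (m * n) ≤ rankF s m * rankF s n := by
  unfold rankF
  rw [Finset.sum_mul_sum, ← Finset.sum_product', Nat.divisors_mul]
  have h : m.divisors * n.divisors =
      (m.divisors ×ˢ n.divisors).image (fun p : ℕ × ℕ => p.1 * p.2) := rfl
  rw [h]
  have key : ∀ p ∈ m.divisors ×ˢ n.divisors,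
      ((p.1 * p.2 : ℕ) : ℝ) ^ (-s) = (p.1 : ℝ) ^ (-s) * (p.2 : ℝ) ^ (-s) := by
    intro p _
    rw [Nat.cast_mul, Real.mul_rpow (Nat.cast_nonneg _) (Nat.cast_nonneg _)]
  rw [← Finset.sum_congr rfl key]
  exact Finset.sum_image_le_of_nonneg (f := fun d : ℕ => (d : ℝ) ^ (-s))
    (fun _ _ => Real.rpow_nonneg (Nat.cast_nonneg _) _)

lemma rankF_prime (s : ℝ) (p : ℕ) (hp : p.Prime) : rankF s p = 1 + (p : ℝ) ^ (-s) := by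
  unfold rankF
  rw [Nat.Prime.divisors hp, Finset.sum_pair hp.one_lt.ne]
  simp

lemma rankF_le_card (s : ℝ) (hs : 0 ≤ s) (n : ℕ) : rankF s n ≤ (n.divisors.card : ℝ) := by
  unfold rankF
  rw [Finset.card_eq_sum_ones, Nat.cast_sum]
  refine Finset.sum_le_sum fun d hd => ?_
  have : 1 ≤ (d : ℝ) := by exact_mod_cast Nat.pos_of_mem_divisors hd
  simpa using Real.rpow_le_one_of_one_le_of_nonpos this (by linarith)

lemma exists_split (s y : ℝ) (hs : 0 ≤ s) (hy : 0 < y) (n : ℕ) (hn : n ≠ 0) :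
    ∃ m l k : ℕ, n = m * l ∧ (∀ p : ℕ, p.Prime → p ∣ m → (p : ℝ) < y) ∧
      rankF s l ≤ (1 + y ^ (-s)) ^ k ∧ y ^ k ≤ (l : ℝ) := by
  induction n using induction_on_primes with
  | zero => exact absurd rfl hn
  | one =>
    refine ⟨1, 1, 0, by simp, ?_, by simp [rankF], by simp⟩
    intro p hp h
    exact absurd h hp.not_dvd_one
  | prime_mul p n hp ih =>
    obtain ⟨m, l, k, rfl, h1, h2, h3⟩ := ih (by rintro rfl; simp at hn)
    by_cases h : (p : ℝ) < y
    · refine ⟨p * m, l, k, by ring, ?_, h2, h3⟩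
      intro q hq hd
      rcases (Nat.Prime.dvd_mul hq).1 hd with h' | h'
      · rwa [(Nat.prime_dvd_prime_iff_eq hq hp).1 h']
      · exact h1 q hq h'
    · push Not at h
      refine ⟨m, p * l, k + 1, by ring, h1, ?_, ?_⟩
      · refine (rankF_mul_le s p l).trans ?_
        rw [rankF_prime s p hp, pow_succ, mul_comm]
        have : (p : ℝ) ^ (-s) ≤ y ^ (-s) :=
          Real.rpow_le_rpow_of_nonpos hy h (by linarith)
        have h0 : 0 ≤ (p : ℝ) ^ (-s) := Real.rpow_nonneg (Nat.cast_nonneg p) _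
        have h5 : 0 ≤ y ^ (-s) := Real.rpow_nonneg hy.le _
        gcongr
      · rw [pow_succ, Nat.cast_mul, mul_comm]
        gcongr

lemma card_divisors_smooth (y : ℝ) (m K : ℕ) (hm : m ≠ 0) (hK : Nat.log 2 m ≤ K) (hy : 0 ≤ y)
    (h : ∀ p : ℕ, p.Prime → p ∣ m → (p : ℝ) < y) :
    (m.divisors.card : ℝ) ≤ ((K : ℝ) + 1) ^ y := by
  have h1 : m.divisors.card ≤ (K + 1) ^ m.primeFactors.card := by
    rw [Nat.card_divisors hm]
    refine Finset.prod_le_pow_card _ _ _ fun p hp => ?_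
    have hpp := Nat.prime_of_mem_primeFactors hp
    have : 2 ^ m.factorization p ≤ m :=
      (Nat.pow_le_pow_left hpp.two_le _).trans
        (Nat.le_of_dvd (Nat.pos_of_ne_zero hm) (Nat.ordProj_dvd m p))
    have := Nat.le_log_of_pow_le (by norm_num) this
    omega
  have h2 : m.primeFactors.card ≤ ⌊y⌋₊ := by
    have : m.primeFactors ⊆ Finset.Icc 1 ⌊y⌋₊ := by
      intro p hp
      have hpp := Nat.prime_of_mem_primeFactors hp
      rw [Finset.mem_Icc]
      exact ⟨hpp.one_le, Nat.le_floor (h p hpp (Nat.dvd_of_mem_primeFactors hp)).le⟩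
    simpa using Finset.card_le_card this
  have h3 : (m.primeFactors.card : ℝ) ≤ y :=
    le_trans (by exact_mod_cast h2) (Nat.floor_le hy)
  calc (m.divisors.card : ℝ) ≤ ((K : ℝ) + 1) ^ m.primeFactors.card := by exact_mod_cast h1
    _ = ((K : ℝ) + 1) ^ (m.primeFactors.card : ℝ) := (Real.rpow_natCast _ _).symm
    _ ≤ _ := Real.rpow_le_rpow_of_exponent_le (by linarith [Nat.cast_nonneg (α := ℝ) K]) h3

/-- Number of divisors of `n` up to `D`. -/
noncomputable def smallDiv (D : ℝ) (n : ℕ) : Finset ℕ :=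
  n.divisors.filter (fun d => (d : ℝ) ≤ D)

lemma smallDiv_le (s D : ℝ) (hs : 0 ≤ s) (hD : 0 < D) (n : ℕ) :
    ((smallDiv D n).card : ℝ) ≤ D ^ s * rankF s n := by
  unfold smallDiv rankF
  rw [Finset.card_eq_sum_ones, Nat.cast_sum, Finset.mul_sum]
  refine le_trans ?_ (Finset.sum_le_sum_of_subset_of_nonneg 
    (Finset.filter_subset (fun d : ℕ => (d : ℝ) ≤ D) n.divisors)
    (fun d _ _ => mul_nonneg (Real.rpow_nonneg hD.le _) (Real.rpow_nonneg (Nat.cast_nonneg d) _)))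
  refine Finset.sum_le_sum fun d hd => ?_
  rw [Finset.mem_filter] at hd
  have h0 : 0 < (d : ℝ) := by exact_mod_cast Nat.pos_of_mem_divisors hd.1
  rw [Real.rpow_neg h0.le, ← div_eq_mul_inv, Nat.cast_one, le_div_iff₀ (Real.rpow_pos_of_pos h0 _),
    one_mul]
  exact Real.rpow_le_rpow h0.le hd.2 hs

lemma smallDiv_bound (s D y Q : ℝ) (hs : 0 ≤ s) (hD : 0 < D) (hy : 1 < y)
    (hQ : 1 ≤ Real.log Q) (hQ0 : 0 < Q) (n : ℕ) (hn : 0 < n) (hnQ : (n : ℝ) ≤ Q) :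
    ((smallDiv D n).card : ℝ) ≤ Real.exp (s * Real.log D + y * Real.log (3 * Real.log Q)
      + Real.log (1 + y ^ (-s)) * (Real.log Q / Real.log y)) := by
  have hy0 : 0 < y := by linarith
  obtain ⟨m, l, k, rfl, h1, h2, h3⟩ := exists_split s y hs hy0 n hn.ne'
  have hm : m ≠ 0 := by rintro rfl; simp at hn
  have hl : l ≠ 0 := by rintro rfl; simp at hn
  have hmQ : (m : ℝ) ≤ Q := le_trans (by
    exact_mod_cast Nat.le_mul_of_pos_right m (Nat.pos_of_ne_zero hl)) hnQ
  have hlQ : (l : ℝ) ≤ Q := le_trans (by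
    exact_mod_cast Nat.le_mul_of_pos_left l (Nat.pos_of_ne_zero hm)) hnQ
  have hK : (Nat.log 2 m : ℝ) + 1 ≤ 3 * Real.log Q := by
    have h4 : ((2 : ℝ) ^ (Nat.log 2 m)) ≤ Q :=
      le_trans (by exact_mod_cast Nat.pow_log_le_self 2 hm) hmQ
    have h5 := Real.log_le_log (by positivity) h4
    rw [Real.log_pow] at h5
    have h6 := Real.log_two_gt_d9
    have : (0 : ℝ) ≤ Nat.log 2 m := Nat.cast_nonneg _
    nlinarith
  have hτ := card_divisors_smooth y m _ hm le_rfl hy0.le h1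
  have hτ' : rankF s m ≤ Real.exp (y * Real.log (3 * Real.log Q)) := by
    refine (rankF_le_card s hs m).trans (hτ.trans ?_)
    refine (Real.rpow_le_rpow (by positivity) hK hy0.le).trans ?_
    rw [Real.rpow_def_of_pos (by linarith), mul_comm]
  have hu : 0 < y ^ (-s) := Real.rpow_pos_of_pos hy0 _
  have hly : 0 < Real.log y := Real.log_pos hy
  have hk : (k : ℝ) ≤ Real.log Q / Real.log y := by
    rw [le_div_iff₀ hly]
    have := Real.log_le_log (by positivity) (h3.trans hlQ)
    rwa [Real.log_pow] at this
  have hL : rankF s l ≤ Real.exp (Real.log (1 + y ^ (-s)) * (Real.log Q / Real.log y)) := by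
    refine h2.trans ?_
    rw [← Real.rpow_natCast, Real.rpow_def_of_pos (by linarith)]
    have : 0 ≤ Real.log (1 + y ^ (-s)) := Real.log_nonneg (by linarith)
    gcongr
  refine (smallDiv_le s D hs hD _).trans ?_
  rw [add_assoc, Real.exp_add, Real.exp_add]
  have hDs : D ^ s = Real.exp (s * Real.log D) := by
    rw [Real.rpow_def_of_pos hD, mul_comm]
  rw [hDs]
  have := (rankF_mul_le s m l).trans (mul_le_mul hτ' hL (rankF_nonneg _ _) (Real.exp_pos _).le)
  gcongr

lemma smallDiv_final (δ : ℝ) (hδ : 0 < δ) (hδ2 : δ ≤ 1 / 2) (η : ℝ) (hη : 0 < η) :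
    ∃ Q₀ : ℝ, ∀ Q : ℝ, Q₀ ≤ Q → 0 < Q ∧ ∀ n : ℕ, 0 < n → (n : ℝ) ≤ Q →
      ((smallDiv (Q ^ δ) n).card : ℝ) ≤ Real.exp
        ((δ * Real.log (1 / δ) + (1 - δ) * Real.log (1 / (1 - δ)) + 2 * η) *
          (Real.log Q / Real.log (Real.log Q))) := by
  set H := δ * Real.log (1 / δ) + (1 - δ) * Real.log (1 / (1 - δ)) with hH
  have hHpos : 0 < H := by
    have h1 : 0 < Real.log (1 / δ) := Real.log_pos (by rw [lt_div_iff₀ hδ]; linarith)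
    have h2 : 0 < Real.log (1 / (1 - δ)) :=
      Real.log_pos (by rw [lt_div_iff₀ (by linarith)]; linarith)
    have : 0 < 1 - δ := by linarith
    positivity
  set θ := H / (H + η) with hθ
  have hθ0 : 0 < θ := by positivity
  have hθ1 : θ < 1 := by rw [hθ, div_lt_one (by positivity)]; linarith
  have hev : ∀ᶠ t : ℝ in Filter.atTop, 3 ≤ t ∧
      ‖Real.log t ^ (2 : ℝ)‖ ≤ (η / 2) * ‖t ^ (1 - θ)‖ :=
    (Filter.eventually_ge_atTop 3).and
      ((isLittleO_log_rpow_rpow_atTop 2 (by linarith : 0 < 1 - θ)).bound (by positivity))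
  obtain ⟨Q₀, hQ₀⟩ := Filter.eventually_atTop.1
    ((Real.tendsto_log_atTop.eventually hev).and (Filter.eventually_gt_atTop 0))
  refine ⟨Q₀, fun Q hQ => ?_⟩
  obtain ⟨⟨ht3, htb⟩, hQpos⟩ := hQ₀ Q hQ
  refine ⟨hQpos, fun n hn hnQ => ?_⟩
  set t := Real.log Q with htdef
  have ht0 : 0 < t := by linarith
  have hlt : 0 < Real.log t := Real.log_pos (by linarith)
  rw [Real.rpow_two, Real.norm_of_nonneg (by positivity), Real.norm_of_nonneg (by positivity)]
    at htb
  set y := t ^ θ with hy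
  have hy1 : 1 < y := Real.one_lt_rpow (by linarith) hθ0
  have hlogy : Real.log y = θ * Real.log t := Real.log_rpow ht0 θ
  have hlogy0 : 0 < Real.log y := by rw [hlogy]; positivity
  set c := Real.log ((1 - δ) / δ) with hc
  have hc0 : 0 ≤ c := Real.log_nonneg (by rw [le_div_iff₀ hδ]; linarith)
  have hb := smallDiv_bound (c / Real.log y) (Q ^ δ) y Q (by positivity) (by positivity) hy1
    (by linarith) hQpos n hn hnQ
  refine hb.trans (Real.exp_le_exp.2 ?_)
  have hu : 1 + y ^ (-(c / Real.log y)) = 1 / (1 - δ) := by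
    rw [Real.rpow_def_of_pos (by linarith)]
    have : Real.log y * -(c / Real.log y) = -c := by field_simp
    rw [this, Real.exp_neg, hc, Real.exp_log (div_pos (by linarith) hδ)]
    have : 1 - δ ≠ 0 := by linarith
    field_simp
    ring
  rw [hu, Real.log_rpow hQpos, ← htdef]
  have hHc : c * δ + Real.log (1 / (1 - δ)) = H := by
    rw [hH, hc, Real.log_div (by linarith) hδ.ne', one_div, one_div, Real.log_inv, Real.log_inv]
    ring
  have e1 : c / Real.log y * (δ * t) + Real.log (1 / (1 - δ)) * (t / Real.log y)
      = (H + η) * (t / Real.log t) := by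
    have : c / Real.log y * (δ * t) + Real.log (1 / (1 - δ)) * (t / Real.log y)
      = (c * δ + Real.log (1 / (1 - δ))) * (t / Real.log y) := by ring
    rw [this, hHc, hlogy, hθ]
    field_simp
  have e2 : y * Real.log (3 * t) ≤ η * (t / Real.log t) := by
    have h3t : Real.log (3 * t) ≤ 2 * Real.log t := by
      rw [Real.log_mul (by norm_num) ht0.ne']
      have := Real.log_le_log (by norm_num) ht3
      linarith
    rw [← mul_div_assoc, le_div_iff₀ hlt]
    have hyt : y * t ^ (1 - θ) = t := by
      rw [hy, ← Real.rpow_add ht0]; simp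
    calc y * Real.log (3 * t) * Real.log t ≤ y * (2 * Real.log t) * Real.log t := by gcongr
      _ = 2 * y * (Real.log t ^ 2) := by ring
      _ ≤ 2 * y * (η / 2 * t ^ (1 - θ)) := by gcongr
      _ = η * (y * t ^ (1 - θ)) := by ring
      _ = η * t := by rw [hyt]
  linarith

lemma quad_card_le (D : ℝ) (A B : Finset ℕ) (hA : ∀ a ∈ A, 0 < a) (hB : ∀ b ∈ B, 0 < b) :
    (((A ×ˢ B) ×ˢ (A ×ˢ B)).filter
            (fun q => q.1.1 * q.2.2 = q.2.1 * q.1.2 ∧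
              (Nat.gcd q.1.1 q.1.2 : ℝ) ≤ D ∧
              (Nat.gcd q.2.1 q.2.2 : ℝ) ≤ D)).card ≤
      ∑ p ∈ A ×ˢ B, (smallDiv D p.1).card * (smallDiv D p.2).card := by
  have : ∑ p ∈ A ×ˢ B, (smallDiv D p.1).card * (smallDiv D p.2).card =
      ((A ×ˢ B).sigma fun p => smallDiv D p.1 ×ˢ smallDiv D p.2).card := by
    rw [Finset.card_sigma]
    simp only [Finset.card_product]
  rw [this]
  refine Finset.card_le_card_of_injOn
    (fun q => ⟨(q.1.1, q.2.2), (Nat.gcd q.1.1 q.1.2, Nat.gcd q.2.1 q.2.2)⟩) ?_ ?_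
  · rintro ⟨⟨a₁, b₁⟩, ⟨a₂, b₂⟩⟩ hq
    simp only [Finset.coe_filter, Set.mem_ofPred_eq, Finset.mem_product] at hq
    obtain ⟨⟨⟨ha1, hb1⟩, ha2, hb2⟩, -, hg1, hg2⟩ := hq
    simp only [smallDiv, Finset.coe_sigma, Set.mem_sigma_iff, Finset.mem_coe, Finset.mem_product,
      Finset.mem_filter, Nat.mem_divisors]
    exact ⟨⟨ha1, hb2⟩, ⟨⟨Nat.gcd_dvd_left _ _, (hA _ ha1).ne'⟩, hg1⟩,
      ⟨Nat.gcd_dvd_right _ _, (hB _ hb2).ne'⟩, hg2⟩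
  · have key : ∀ a₁ b₁ a₂ b₂ : ℕ, a₁ * b₂ = a₂ * b₁ →
        b₁ * Nat.gcd a₂ b₂ = Nat.gcd a₁ b₁ * b₂ ∧ a₂ * Nat.gcd a₁ b₁ = a₁ * Nat.gcd a₂ b₂ := by
      intro a₁ b₁ a₂ b₂ h
      constructor
      · rw [← Nat.gcd_mul_left, ← Nat.gcd_mul_right, h, mul_comm b₁ a₂]
      · rw [← Nat.gcd_mul_left, ← Nat.gcd_mul_left, h, mul_comm a₁ a₂]
    rintro ⟨⟨a₁, b₁⟩, ⟨a₂, b₂⟩⟩ hq ⟨⟨a₁', b₁'⟩, ⟨a₂', b₂'⟩⟩ hq' heq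
    simp only [Finset.coe_filter, Set.mem_ofPred_eq, Finset.mem_product] at hq hq'
    simp only [Sigma.mk.injEq, Prod.mk.injEq, heq_eq_eq] at heq
    obtain ⟨⟨rfl, rfl⟩, h1, h2⟩ := heq
    obtain ⟨⟨⟨ha1, hb1⟩, ha2, hb2⟩, he, -⟩ := hq
    obtain ⟨-, he', -⟩ := hq'
    obtain ⟨k1, k2⟩ := key _ _ _ _ he
    obtain ⟨k1', k2'⟩ := key _ _ _ _ he'
    rw [← h1, ← h2] at k1' k2'
    have p1 : 0 < Nat.gcd a₁ b₁ := Nat.gcd_pos_of_pos_left _ (hA _ ha1)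
    have p2 : 0 < Nat.gcd a₂ b₂ := Nat.gcd_pos_of_pos_right _ (hB _ hb2)
    have r1 : b₁ = b₁' := Nat.eq_of_mul_eq_mul_right p2 (k1.trans k1'.symm)
    have r2 : a₂ = a₂' := Nat.eq_of_mul_eq_mul_right p1 (k2.trans k2'.symm)
    rw [r1, r2]

/-- For every δ with 0 < δ ≤ 1/2 and every η > 0 there exists Q₀ such that for all
real Q ≥ Q₀ and all finite sets A, B of positive integers contained in [1, Q], the
number of quadruples (a₁, b₁, a₂, b₂) ∈ A × B × A × B with a₁·b₂ = a₂·b₁,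
gcd(a₁, b₁) ≤ Q^δ and gcd(a₂, b₂) ≤ Q^δ is at most
|A|·|B|·exp((2·(δ·log(1/δ) + (1−δ)·log(1/(1−δ))) + η)·(log Q)/(log log Q)). -/
theorem stmt_16 :
    ∀ δ : ℝ, 0 < δ → δ ≤ 1 / 2 → ∀ η : ℝ, 0 < η → ∃ Q₀ : ℝ, ∀ Q : ℝ, Q₀ ≤ Q →
      ∀ A B : Finset ℕ,
        (∀ a ∈ A, 0 < a ∧ (a : ℝ) ≤ Q) →
        (∀ b ∈ B, 0 < b ∧ (b : ℝ) ≤ Q) →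
        ((((A ×ˢ B) ×ˢ (A ×ˢ B)).filter
            (fun q => q.1.1 * q.2.2 = q.2.1 * q.1.2 ∧
              (Nat.gcd q.1.1 q.1.2 : ℝ) ≤ Q ^ δ ∧
              (Nat.gcd q.2.1 q.2.2 : ℝ) ≤ Q ^ δ)).card : ℝ) ≤
          (A.card : ℝ) * (B.card : ℝ) *
            Real.exp ((2 * (δ * Real.log (1 / δ) + (1 - δ) * Real.log (1 / (1 - δ))) + η) *
              (Real.log Q / Real.log (Real.log Q))) := by
  intro δ hδ hδ2 η hη
  obtain ⟨Q₀, hQ₀⟩ := smallDiv_final δ hδ hδ2 (η / 4) (by positivity)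
  refine ⟨Q₀, fun Q hQ A B hA hB => ?_⟩
  obtain ⟨hQpos, hN⟩ := hQ₀ Q hQ
  have h1 := quad_card_le (Q ^ δ) A B (fun a ha => (hA a ha).1) (fun b hb => (hB b hb).1)
  refine le_trans (Nat.cast_le.2 h1) ?_
  rw [Nat.cast_sum]
  set E := (δ * Real.log (1 / δ) + (1 - δ) * Real.log (1 / (1 - δ)) + 2 * (η / 4)) *
          (Real.log Q / Real.log (Real.log Q)) with hE
  have h2 : ∀ p ∈ A ×ˢ B, (((smallDiv (Q ^ δ) p.1).card * (smallDiv (Q ^ δ) p.2).card : ℕ) : ℝ)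
      ≤ Real.exp E * Real.exp E := by
    intro p hp
    rw [Finset.mem_product] at hp
    rw [Nat.cast_mul]
    exact mul_le_mul (hN _ (hA _ hp.1).1 (hA _ hp.1).2) (hN _ (hB _ hp.2).1 (hB _ hp.2).2)
      (Nat.cast_nonneg _) (Real.exp_pos _).le
  refine (Finset.sum_le_card_nsmul _ _ _ h2).trans (le_of_eq ?_)
  rw [nsmul_eq_mul, Finset.card_product, Nat.cast_mul, ← Real.exp_add]
  congr 2
  rw [hE]
  ring
end
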